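/- arXiv:1903.12526 — 2 statements merged into one kernel-verified Lean document; each statement's English description precedes it below -/
import Mathlib

section
/- Take the parameters ϱ_l in the recursion to be the moments of the measure, with ϱ₀ ≠ 0. Then for every g ≥ 1: (i) G_g(z) is an odd Laurent polynomial in z containing only negative odd powers of z (in particular bounded at ∞ and holomorphic on ℂ∖{0}); (ii) for every admissible z, K̂(G_g)(z) = −(1/2)·Σ_{h=1}^{g−1} G_h(z)·G_{g−h}(z) − 2λ²·G_{g−1}(z|z), where G₀(z|z) := λ²/z⁴ and G_{g−1}(z|z) := (2λ)²(Â†_z + (1/(ϱ₀z⁴))·∂/∂z)G_{g−1}(z) for g ≥ 2. -/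
open scoped BigOperators
open MeasureTheory

noncomputable section

namespace NCQFT

/-! ### Measure data: the planar 1‑point function `G0fun`, the moments and the operator `K̂`. -/

/-- The planar one-point function `𝒢₀(z) = s·z − n̄ + ½∫ᵃᵇ r(y)/((z+y)y) dy`. -/
def G0fun (a b s nbar : ℝ) (r : ℝ → ℝ) (z : ℂ) : ℂ :=
  (s : ℂ) * z - (nbar : ℂ) + (1 / 2) * ∫ y in a..b, (r y : ℂ) / ((z + (y : ℂ)) * (y : ℂ))

/-- Moments `ϱ_l = s·δ_{l,0} − ½∫ᵃᵇ r(y)/y^{3+2l} dy` of the measure. -/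
def moment (a b s : ℝ) (r : ℝ → ℝ) (l : ℕ) : ℝ :=
  (if l = 0 then s else 0) - (1 / 2) * ∫ y in a..b, r y / y ^ (3 + 2 * l)

/-- The integral operator `K̂`. -/
def Khat (a b s nbar : ℝ) (r : ℝ → ℝ) (f : ℂ → ℂ) (z : ℂ) : ℂ :=
  G0fun a b s nbar r z * f z + (nbar : ℂ) * f z
    + (1 / 2) * ∫ y in a..b, (r y : ℂ) * (f z - f (y : ℂ)) / (z ^ 2 - (y : ℂ) ^ 2)

/-- Admissible points: `z ∉ [a,b] ∪ (−[a,b]) ∪ {0}`. -/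
def Admissible (a b : ℝ) (z : ℂ) : Prop :=
  z ≠ 0 ∧ ∀ y : ℝ, y ∈ Set.Icc a b → z ≠ (y : ℂ) ∧ z ≠ -(y : ℂ)

/-! ### Partial Bell polynomials and the polynomials `S_m(ϱ)`. -/

/-- Partial Bell polynomial `B_{n,k}(x₁,…,x_{n−k+1})`. -/
def bellP (n k : ℕ) (x : ℕ → ℝ) : ℝ :=
  ∑ j : Fin n → Fin (n + 1),
    if (∑ i : Fin n, (j i : ℕ)) = k ∧ (∑ i : Fin n, ((i : ℕ) + 1) * (j i : ℕ)) = n then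
      (n.factorial : ℝ) / (∏ i : Fin n, ((j i : ℕ).factorial : ℝ)) *
        ∏ i : Fin n, (x ((i : ℕ) + 1) / (((i : ℕ) + 1).factorial : ℝ)) ^ (j i : ℕ)
    else 0

/-- `S_m(ϱ) = Σ_{i=0}^m (−1)^i i! ϱ₀^{−i} B_{m,i}(1!ϱ₁,…,(m−i+1)!ϱ_{m−i+1})`. -/
def Sm (ρ : ℕ → ℝ) (m : ℕ) : ℝ :=
  ∑ i ∈ Finset.range (m + 1),
    (-1) ^ i * (i.factorial : ℝ) * ((ρ 0)⁻¹) ^ i *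
      bellP m i (fun j => (j.factorial : ℝ) * ρ j)

/-! ### Partial derivatives in the moment variables. -/

/-- Partial derivative `∂/∂ϱ_l` of a real-valued function of the moments. -/
def pdR (c : (ℕ → ℝ) → ℝ) (l : ℕ) (ρ : ℕ → ℝ) : ℝ :=
  deriv (fun t => c (Function.update ρ l t)) (ρ l)

/-- Partial derivative `∂/∂ϱ_l` of a complex-valued function of the moments. -/
def pdC (c : (ℕ → ℝ) → ℂ) (l : ℕ) (ρ : ℕ → ℝ) : ℂ :=
  deriv (fun t : ℝ => c (Function.update ρ l t)) (ρ l)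

/-! ### Boundary creation operators. -/

/-- Boundary creation operator `Â†_{z_J,w}` with free creation variable `w`, acting on a
family `F` of the moments `ϱ` and boundary variables `(z_i)_{i∈J}`. -/
def AdagFree (J : Finset ℕ) (F : (ℕ → ℝ) → (ℕ → ℂ) → ℂ)
    (ρ : ℕ → ℝ) (z : ℕ → ℂ) (w : ℂ) : ℂ :=
  (∑' l : ℕ, (-((3 + 2 * (l : ℂ)) * (ρ (l + 1) : ℂ)) / ((ρ 0 : ℂ) * w ^ 3)
      + (3 + 2 * (l : ℂ)) / w ^ (5 + 2 * l)) * pdC (fun σ => F σ z) l ρ)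
  + ∑ i ∈ J, (1 / ((ρ 0 : ℂ) * w ^ 3 * z i)) *
      deriv (fun v => F ρ (Function.update z i v)) (z i)

/-- Boundary creation operator creating a boundary at coordinate `p`. -/
def AdagVar (J : Finset ℕ) (p : ℕ) (F : (ℕ → ℝ) → (ℕ → ℂ) → ℂ) :
    (ℕ → ℝ) → (ℕ → ℂ) → ℂ :=
  fun ρ z => AdagFree J F ρ z (z p)

/-- Boundary creation operator `Â†_w` acting on scalar functions of the moments only. -/
def AdagScalar (F : (ℕ → ℝ) → ℝ) (ρ : ℕ → ℝ) (w : ℂ) : ℂ :=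
  ∑' l : ℕ, (-((3 + 2 * (l : ℂ)) * (ρ (l + 1) : ℂ)) / ((ρ 0 : ℂ) * w ^ 3)
      + (3 + 2 * (l : ℂ)) / w ^ (5 + 2 * l)) * (pdR F l ρ : ℂ)

/-! ### The genus recursion for the 1-boundary functions `𝒢_g(z) = Σ_k c_{g,k}(ϱ)/z^{2k+3}`. -/

/-- Coefficients `e_m(ϱ)` of the even bracket
`w²·(Σ_{h=1}^{g-1} G_h(w)G_{g−h}(w) + (2λ)²·G_{g−1}(w|w))`, expressed through the table
`prev` of the coefficients of the lower-genus one-boundary functions. -/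
def eBr (lam : ℝ) (g : ℕ) (prev : ℕ → ℕ → (ℕ → ℝ) → ℝ) (m : ℕ) (ρ : ℕ → ℝ) : ℝ :=
  (∑ h ∈ Finset.Icc 1 (g - 1), ∑ i ∈ Finset.range (m + 1), ∑ j ∈ Finset.range (m + 1),
      if i + j + 2 = m then prev h i ρ * prev (g - h) j ρ else 0)
  + (2 * lam) ^ 4 *
    ((if 2 ≤ m then
        -(1 / ρ 0) * ∑' l : ℕ, (3 + 2 * (l : ℝ)) * ρ (l + 1) * pdR (prev (g - 1) (m - 2)) l ρ
      else 0)
    + (∑ k ∈ Finset.range (m + 1), ∑ l ∈ Finset.range (m + 1),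
        if k + l + 3 = m then (3 + 2 * (l : ℝ)) * pdR (prev (g - 1) k) l ρ else 0)
    + (if 3 ≤ m then -(((2 * (m - 3) + 3 : ℕ) : ℝ) * prev (g - 1) (m - 3) ρ) / ρ 0 else 0))

/-- Table of the coefficients of the one-boundary functions for all genera `h ≤ G`.
`Gtab lam G h k ρ` is the coefficient of `z^{-(2k+3)}` in `𝒢_h(z)`. -/
def Gtab (lam : ℝ) : ℕ → ℕ → ℕ → (ℕ → ℝ) → ℝ
  | 0 => fun _ _ _ => 0
  | 1 => fun h k ρ =>
      if h = 1 then
        (if k = 0 then 2 * lam ^ 4 * ρ 1 / (ρ 0) ^ 2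
         else if k = 1 then -(2 * lam ^ 4) / ρ 0 else 0)
      else 0
  | (G + 2) => fun h k ρ =>
      if h ≤ G + 1 then Gtab lam (G + 1) h k ρ
      else if h = G + 2 then
        -(1 / (2 * ρ 0)) *
          ∑' j : ℕ, eBr lam (G + 2) (Gtab lam (G + 1)) (k + j) ρ * Sm ρ j / (j.factorial : ℝ)
      else 0

/-- Coefficients of the genus-`g` one-boundary function. -/
def Gcoef (lam : ℝ) (g : ℕ) : ℕ → (ℕ → ℝ) → ℝ := Gtab lam g g

/-- One-boundary function `𝒢_g(z)` of genus `g ≥ 1`. -/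
def Gfun (lam : ℝ) (g : ℕ) (ρ : ℕ → ℝ) (z : ℂ) : ℂ :=
  ∑' k : ℕ, (Gcoef lam g k ρ : ℂ) / z ^ (2 * k + 3)

/-- The same-point two-boundary function `𝒢_g(z|z)`, with
`𝒢₀(z|z) := λ²/z⁴` and `𝒢_g(z|z) := (2λ)²(Â†_z + (1/(ϱ₀z⁴))∂_z)𝒢_g(z)` for `g ≥ 1`. -/
def Gpair (lam : ℝ) (g : ℕ) (ρ : ℕ → ℝ) (z : ℂ) : ℂ :=
  if g = 0 then (lam : ℂ) ^ 2 / z ^ 4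
  else (2 * (lam : ℂ)) ^ 2 *
    ((∑' l : ℕ, (-((3 + 2 * (l : ℂ)) * (ρ (l + 1) : ℂ)) / ((ρ 0 : ℂ) * z ^ 3)
        + (3 + 2 * (l : ℂ)) / z ^ (5 + 2 * l)) * pdC (fun σ => Gfun lam g σ z) l ρ)
     + (1 / ((ρ 0 : ℂ) * z ^ 4)) * deriv (Gfun lam g ρ) z)

/-! ### Multi-boundary functions. -/

/-- Iterated boundary creation for `g ≥ 1` (without prefactors); coordinates `0,…,B−1`. -/
def GBraw (lam : ℝ) (g : ℕ) : ℕ → (ℕ → ℝ) → (ℕ → ℂ) → ℂ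
  | 0 => fun _ _ => 0
  | 1 => fun ρ z => Gfun lam g ρ (z 0)
  | (B + 2) => AdagVar (Finset.range (B + 1)) (B + 1) (GBraw lam g (B + 1))

/-- Iterated boundary creation for `g = 0` (without prefactors), starting from `𝒢₀(z₁|z₂)`. -/
def GBraw0 (lam : ℝ) : ℕ → (ℕ → ℝ) → (ℕ → ℂ) → ℂ
  | 0 => fun _ _ => 0
  | 1 => fun _ _ => 0
  | 2 => fun _ z => 4 * (lam : ℂ) ^ 2 / (z 0 * z 1 * (z 0 + z 1) ^ 2)
  | (B + 3) => AdagVar (Finset.range (B + 2)) (B + 2) (GBraw0 lam (B + 2))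

/-- The multi-boundary functions `𝒢_g(z₁|…|z_B)`, with variables at coordinates `0,…,B−1`:
`𝒢_g(z₁|…|z_B) = (2λ)^{3B−4} Â†_{(z₁..z_{B−1}),z_B}(⋯ Â†_{(z₁),z₂}𝒢_g(z₁)⋯)` for `g ≥ 1`,
and `𝒢₀(z₁|…|z_B) = (2λ)^{3B−6} Â†(⋯ Â†𝒢₀(z₁|z₂)⋯)` for `g = 0`. -/
def GBfun (lam : ℝ) (g B : ℕ) (ρ : ℕ → ℝ) (z : ℕ → ℂ) : ℂ :=
  if g = 0 then (2 * (lam : ℂ)) ^ (3 * B - 6) * GBraw0 lam B ρ z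
  else if B = 1 then Gfun lam g ρ (z 0)
  else (2 * (lam : ℂ)) ^ (3 * B - 4) * GBraw lam g B ρ z

/-! ### Free energies and boundary annihilation. -/

/-- Boundary annihilation applied to `𝒢_g`:  `Â_ǎ 𝒢_g = −Σ_l ϱ_l/(3+2l) · c_{g,l+1}(ϱ)`
(the coefficient of `z^{−5−2l}` in `𝒢_g(z)` is `c_{g,l+1}`). -/
def AcheckG (lam : ℝ) (g : ℕ) (ρ : ℕ → ℝ) : ℝ :=
  -∑' l : ℕ, ρ l / (3 + 2 * (l : ℝ)) * Gcoef lam g (l + 1) ρ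

/-- Free energies: `F₁ = −(1/24)·log ϱ₀`, and
`F_g = (1/((2g−2)(2λ)⁴))·Â_ǎ(𝒢_g)` for `g ≥ 2`. -/
def Ffree (lam : ℝ) (g : ℕ) (ρ : ℕ → ℝ) : ℝ :=
  if g = 1 then -(1 / 24) * Real.log (ρ 0)
  else 1 / ((2 * (g : ℝ) - 2) * (2 * lam) ^ 4) * AcheckG lam g ρ

/-! ### Auxiliary notions. -/

/-- Variable assignment `(z₁, z_{i₁}, z_{i₂}, …)` with first slot `w` and the remaining slots
filled by the coordinates of `z` indexed by the set `I` in increasing order. -/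
def slotAt (z : ℕ → ℂ) (w : ℂ) (I : Finset ℕ) : ℕ → ℂ :=
  fun n => if n = 0 then w else z ((I.sort (· ≤ ·)).getD (n - 1) 0)

/-- A polynomial in variables `x₁,…,x_j` is `j`-weighted if each of its monomials
`∏ x_i^{m_i}` satisfies `Σ i·m_i = j`. -/
def IsWeighted (j : ℕ) (P : MvPolynomial (Fin j) ℚ) : Prop :=
  ∀ m ∈ P.support, (∑ i : Fin j, ((i : ℕ) + 1) * m i) = j

/-- A smooth family `F(ϱ₀,…,ϱ_M; (z_i)_{i∈J})`: it factors through a function of the first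
`M+1` moments and the coordinates in `J` which is smooth (and holomorphic in each `z_i`)
on the region `ϱ₀ ≠ 0`, `z_i ≠ 0`. -/
def SmoothFam (M : ℕ) (J : Finset ℕ) (F : (ℕ → ℝ) → (ℕ → ℂ) → ℂ) : Prop :=
  ∃ Ft : ((Fin (M + 1) → ℝ) × ({ i // i ∈ J } → ℂ)) → ℂ,
    ContDiffOn ℝ (⊤ : ℕ∞) Ft { x | x.1 0 ≠ 0 ∧ ∀ i, x.2 i ≠ 0 } ∧
    (∀ x ∈ ({ x : (Fin (M + 1) → ℝ) × ({ i // i ∈ J } → ℂ) |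
        x.1 0 ≠ 0 ∧ ∀ i, x.2 i ≠ 0 }), ∀ i,
      DifferentiableAt ℂ (fun w => Ft (x.1, Function.update x.2 i w)) (x.2 i)) ∧
    ∀ ρ z, F ρ z = Ft (fun l => ρ (l : ℕ), fun i => z (i : ℕ))

/-- A smooth scalar function of `ϱ₀ ≠ 0, ϱ₁, …, ϱ_M`. -/
def SmoothScalarFam (M : ℕ) (F : (ℕ → ℝ) → ℝ) : Prop :=
  ∃ Ft : (Fin (M + 1) → ℝ) → ℝ,
    ContDiffOn ℝ (⊤ : ℕ∞) Ft { v | v 0 ≠ 0 } ∧ ∀ ρ : ℕ → ℝ, F ρ = Ft (fun l => ρ (l : ℕ))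

/-! ### The Laplacian of Theorem `Δ_ϱ`. -/

/-- `R_m(ϱ) = −(2/3) Σ_{k=1}^m (kϱ_k/((3+2k)ϱ₀))·S_{m−k}(ϱ)/(m−k)!`. -/
def Rm (ρ : ℕ → ℝ) (m : ℕ) : ℝ :=
  -(2 / 3) * ∑ k ∈ Finset.Icc 1 m,
    ((k : ℝ) * ρ k / ((3 + 2 * (k : ℝ)) * ρ 0)) * (Sm ρ (m - k) / ((m - k).factorial : ℝ))

/-- The Laplacian `Δ_ϱ`, acting on functions of the moments. -/
def DeltaRho (F : (ℕ → ℝ) → ℝ) (ρ : ℕ → ℝ) : ℝ :=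
  -(-(6 * ρ 1 ^ 3) / (5 * ρ 0 ^ 3) + 111 * ρ 1 * ρ 2 / (70 * ρ 0 ^ 2)
      - ρ 3 / (2 * ρ 0)) * pdR (fun σ => pdR F 0 σ) 0 ρ
  - (2 * ρ 1 ^ 3 / ρ 0 ^ 4 - 1097 * ρ 1 * ρ 2 / (280 * ρ 0 ^ 3)
      + 41 * ρ 3 / (24 * ρ 0 ^ 2)) * pdR F 0 ρ
  - (∑' k : ℕ, (3 + 2 * ((k : ℝ) + 1)) *
      ((-(2 * ρ 1 ^ 2 / (5 * ρ 0 ^ 3)) + 2 * ρ 2 / (7 * ρ 0 ^ 2)) * ρ (k + 2)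
        - 3 * Rm ρ (k + 3) * ρ 1 / (2 * ρ 0) + 3 * Rm ρ (k + 4) / 2) *
      pdR (fun σ => pdR F 0 σ) (k + 1) ρ)
  - (∑' k : ℕ, ∑' l : ℕ, (3 + 2 * ((k : ℝ) + 1)) * (3 + 2 * ((l : ℝ) + 1)) *
      (-(ρ 1 * ρ (l + 2) * ρ (k + 2) / (30 * ρ 0 ^ 2))
        - ρ (k + 2) * Rm ρ (l + 3) / (4 * ρ 0)
        - ρ (l + 2) * Rm ρ (k + 3) / (4 * ρ 0)
        + Rm ρ (k + l + 5) / 4) *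
      pdR (fun σ => pdR F (l + 1) σ) (k + 1) ρ)
  - (∑' k : ℕ, (3 + 2 * ((k : ℝ) + 1)) *
      ((19 * ρ 1 ^ 2 / (60 * ρ 0 ^ 4) - 25 * ρ 2 / (84 * ρ 0 ^ 3)) * ρ (k + 2)
        + ρ 1 * Rm ρ (k + 3) / (16 * ρ 0 ^ 2)
        - Rm ρ (k + 4) / (16 * ρ 0)
        - (5 + 2 * ((k : ℝ) + 1)) * ρ 1 * ρ (k + 3) / (30 * ρ 0 ^ 3)
        - (5 + 2 * ((k : ℝ) + 1)) * Rm ρ (k + 4) / (2 * ρ 0)) *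
      pdR F (k + 1) ρ)

/-- The operator `D = −(2λ)⁴Δ_ϱ + (2λ)⁴·(−21ϱ₁³/(160ϱ₀⁵)+29ϱ₁ϱ₂/(128ϱ₀⁴)−35ϱ₃/(384ϱ₀³))·`. -/
def Dop (lam : ℝ) (F : (ℕ → ℝ) → ℝ) : (ℕ → ℝ) → ℝ :=
  fun ρ => -(2 * lam) ^ 4 * DeltaRho F ρ
    + (2 * lam) ^ 4 * (-(21 / 160) * ρ 1 ^ 3 / ρ 0 ^ 5 + (29 / 128) * ρ 1 * ρ 2 / ρ 0 ^ 4
        - (35 / 384) * ρ 3 / ρ 0 ^ 3) * F ρ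

end NCQFT

namespace NCQFT

/-! ### Helper lemmas: the series of `S_m/m!`. -/

lemma aux_coeff_pow {m : ℕ} (u : Fin m → ℝ) (k : ℕ) (hk : k ≤ m) :
    PowerSeries.coeff m ((∑ i : Fin m, PowerSeries.monomial ((i : ℕ) + 1) (u i)) ^ k)
      = ∑ j : Fin m → Fin (m + 1),
        if (∑ i : Fin m, (j i : ℕ)) = k ∧ (∑ i : Fin m, ((i : ℕ) + 1) * (j i : ℕ)) = m then
          (k.factorial : ℝ) / (∏ i : Fin m, ((j i : ℕ).factorial : ℝ)) *
            ∏ i : Fin m, u i ^ (j i : ℕ) else 0 := by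
  classical
  have hmon : ∀ κ : Fin m → ℕ,
      (∏ i : Fin m, (PowerSeries.monomial ((i : ℕ) + 1) (u i)) ^ (κ i))
        = PowerSeries.C (∏ i, u i ^ κ i) * PowerSeries.X ^ (∑ i : Fin m, ((i : ℕ) + 1) * κ i) := by
    intro κ
    have hm : ∀ i : Fin m, PowerSeries.monomial ((i : ℕ) + 1) (u i)
        = PowerSeries.C (u i) * PowerSeries.X ^ ((i : ℕ) + 1) := by
      intro i
      ext n
      rw [PowerSeries.coeff_C_mul_X_pow, PowerSeries.coeff_monomial]
    simp only [hm, mul_pow, Finset.prod_mul_distrib, map_prod, map_pow,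
      ← pow_mul, Finset.prod_pow_eq_pow_sum]
  rw [Finset.sum_pow_eq_sum_piAntidiag, map_sum]
  simp only [hmon]
  rw [← Finset.sum_filter]
  symm
  have : ∀ κ ∈ (Finset.univ : Finset (Fin m)).piAntidiag k,
      PowerSeries.coeff m ((Nat.multinomial Finset.univ κ : PowerSeries ℝ) *
        (PowerSeries.C (∏ i, u i ^ κ i) * PowerSeries.X ^ (∑ i : Fin m, ((i : ℕ) + 1) * κ i)))
      = if (∑ i : Fin m, ((i : ℕ) + 1) * κ i) = m then
          (k.factorial : ℝ) / (∏ i : Fin m, ((κ i).factorial : ℝ)) *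
            ∏ i : Fin m, u i ^ (κ i) else 0 := by
    intro κ hκ
    rw [Finset.mem_piAntidiag] at hκ
    have h1 := Nat.multinomial_spec (Finset.univ : Finset (Fin m)) κ
    rw [hκ.1] at h1
    have h2 : (Nat.multinomial Finset.univ κ : ℝ)
        = (k.factorial : ℝ) / (∏ i : Fin m, ((κ i).factorial : ℝ)) := by
      rw [eq_div_iff]
      · rw [← h1]; push_cast; ring
      · exact Finset.prod_ne_zero_iff.2 fun i _ => by exact_mod_cast Nat.factorial_ne_zero _
    have h3 : (Nat.multinomial Finset.univ κ : PowerSeries ℝ)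
        = PowerSeries.C (Nat.multinomial Finset.univ κ : ℝ) := by simp
    rw [h3, h2, PowerSeries.coeff_C_mul, PowerSeries.coeff_C_mul, PowerSeries.coeff_X_pow]
    by_cases h : (∑ i : Fin m, ((i : ℕ) + 1) * κ i) = m
    · simp [h]
    · rw [if_neg h, if_neg (Ne.symm h)]; simp
  rw [Finset.sum_congr rfl this, ← Finset.sum_filter]
  refine Finset.sum_bij (fun j _ => fun i => (j i : ℕ)) ?_ ?_ ?_ ?_
  · intro j hj
    simp only [Finset.mem_filter, Finset.mem_univ, true_and] at hj
    simp [Finset.mem_piAntidiag, hj.1, hj.2]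
  · intro j _ j' _ h
    funext i
    exact Fin.ext (congrFun h i)
  · intro κ hκ
    simp only [Finset.mem_filter, Finset.mem_piAntidiag] at hκ
    have hle : ∀ i, κ i < m + 1 := fun i => by
      have := Finset.single_le_sum (f := κ) (fun _ _ => Nat.zero_le _) (Finset.mem_univ i)
      have h2 : ∑ x, κ x = k := hκ.1.1
      exact Nat.lt_succ_of_le (this.trans (h2.le.trans hk))
    refine ⟨fun i => ⟨κ i, hle i⟩, ?_, rfl⟩
    simp [hκ.1.1, hκ.2]
  · intro j _
    rfl

/-- Normalised `S_m/m!`. -/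
def Tm (ρ : ℕ → ℝ) (m : ℕ) : ℝ := Sm ρ m / (m.factorial : ℝ)

lemma Tm_eq (ρ : ℕ → ℝ) (m : ℕ) :
    Tm ρ m = ∑ k ∈ Finset.range (m + 1), PowerSeries.coeff m
      ((∑ i : Fin m, PowerSeries.monomial ((i : ℕ) + 1) (-(ρ 0)⁻¹ * ρ ((i : ℕ) + 1))) ^ k) := by
  unfold Tm Sm
  rw [Finset.sum_div]
  refine Finset.sum_congr rfl fun k hk => ?_
  rw [aux_coeff_pow _ _ (by simpa [Nat.lt_succ_iff] using hk)]
  unfold bellP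
  rw [Finset.mul_sum, Finset.sum_div]
  refine Finset.sum_congr rfl fun j _ => ?_
  split_ifs with h
  · have hf : ∀ n : ℕ, (n.factorial : ℝ) ≠ 0 := fun n => by exact_mod_cast Nat.factorial_ne_zero _
    have h1 : (∏ i : Fin m, (-(ρ 0)⁻¹ * ρ ((i : ℕ) + 1)) ^ (j i : ℕ))
        = (-1) ^ k * (ρ 0)⁻¹ ^ k * ∏ i : Fin m, ρ ((i : ℕ) + 1) ^ (j i : ℕ) := by
      simp only [mul_pow, Finset.prod_mul_distrib, Finset.prod_pow_eq_pow_sum, h.1]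
      rw [← mul_pow, neg_one_mul]
    have h2 : ∀ i : Fin m, (((i : ℕ) + 1).factorial : ℝ) * ρ ((i : ℕ) + 1)
        / (((i : ℕ) + 1).factorial : ℝ) = ρ ((i : ℕ) + 1) := fun i => by
      rw [mul_div_cancel_left₀ _ (hf _)]
    simp only [h2]
    rw [h1]
    have := hf m
    have h3 : (∏ i : Fin m, ((j i : ℕ).factorial : ℝ)) ≠ 0 :=
      Finset.prod_ne_zero_iff.2 fun i _ => hf _
    field_simp
  · simp

lemma series_mul (ρ : ℕ → ℝ) (h0 : ρ 0 ≠ 0) :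
    PowerSeries.mk (Tm ρ) * PowerSeries.mk ρ = PowerSeries.C (ρ 0) := by
  set U : PowerSeries ℝ := PowerSeries.mk (fun j => if j = 0 then 0 else -(ρ 0)⁻¹ * ρ j) with hU
  have hR : PowerSeries.mk ρ = PowerSeries.C (ρ 0) * (1 - U) := by
    ext n
    rw [PowerSeries.coeff_C_mul]
    rcases n with _ | n
    · simp [hU]
    · simp only [hU, map_sub, PowerSeries.coeff_mk, PowerSeries.coeff_one]
      simp
      field_simp
  have hX : (PowerSeries.X : PowerSeries ℝ) ∣ U := by
    rw [PowerSeries.X_dvd_iff]; simp [hU]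
  have hc : PowerSeries.constantCoeff (1 - U) ≠ 0 := by simp [hU]
  have hT : PowerSeries.mk (Tm ρ) = (1 - U)⁻¹ := by
    ext m
    rw [PowerSeries.coeff_mk, Tm_eq]
    have e1 : ∀ k, PowerSeries.coeff m ((∑ i : Fin m, PowerSeries.monomial ((i : ℕ) + 1)
        (-(ρ 0)⁻¹ * ρ ((i : ℕ) + 1))) ^ k) = PowerSeries.coeff m (U ^ k) := by
      intro k
      have hd : (PowerSeries.X : PowerSeries ℝ) ^ (m + 1) ∣
          (∑ i : Fin m, PowerSeries.monomial ((i : ℕ) + 1) (-(ρ 0)⁻¹ * ρ ((i : ℕ) + 1))) - U := by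
        rw [PowerSeries.X_pow_dvd_iff]
        intro n hn
        rw [map_sub, map_sum, sub_eq_zero]
        rw [Fin.sum_univ_eq_sum_range (fun i => PowerSeries.coeff n
          (PowerSeries.monomial (i + 1) (-(ρ 0)⁻¹ * ρ (i + 1)))) m]
        simp only [PowerSeries.coeff_monomial, hU, PowerSeries.coeff_mk]
        rcases n with _ | n
        · simp
        · simp
          intro h; omega
      have := (PowerSeries.X_pow_dvd_iff.1 (hd.trans (sub_dvd_pow_sub_pow _ U k))) m (by omega)
      rwa [map_sub, sub_eq_zero] at this
    simp only [e1]
    rw [← map_sum]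
    have e2 : (∑ k ∈ Finset.range (m + 1), U ^ k) = (1 - U)⁻¹ - (1 - U)⁻¹ * U ^ (m + 1) := by
      have h1 : (1 - U) * (∑ k ∈ Finset.range (m + 1), U ^ k) = 1 - U ^ (m + 1) :=
        mul_neg_geom_sum U (m + 1)
      have h2 := PowerSeries.inv_mul_cancel (1 - U) hc
      calc _ = ((1 - U)⁻¹ * (1 - U)) * (∑ k ∈ Finset.range (m + 1), U ^ k) := by rw [h2, one_mul]
        _ = _ := by rw [mul_assoc, h1]; ring
    rw [e2, map_sub, sub_eq_self]
    have hd : (PowerSeries.X : PowerSeries ℝ) ^ (m + 1) ∣ (1 - U)⁻¹ * U ^ (m + 1) :=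
      (pow_dvd_pow_of_dvd hX _).mul_left _
    exact (PowerSeries.X_pow_dvd_iff.1 hd) m (by omega)
  rw [hT, hR, mul_left_comm, PowerSeries.inv_mul_cancel _ hc, mul_one]

/-! ### Functions of the moments that are polynomial in `1/ϱ₀, ϱ₀, ϱ₁, …`. -/

/-- Valuation sending `none` to `1/ϱ₀` and `some l` to `ϱ_l`. -/
def Vv (ρ : ℕ → ℝ) : Option ℕ → ℝ
  | none => (ρ 0)⁻¹
  | some l => ρ l

/-- Polynomial in `1/ϱ₀` and the moments, on `ϱ₀ ≠ 0`. -/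
def Good (c : (ℕ → ℝ) → ℝ) : Prop :=
  ∃ P : MvPolynomial (Option ℕ) ℝ, ∀ ρ : ℕ → ℝ, ρ 0 ≠ 0 → c ρ = MvPolynomial.eval (Vv ρ) P

lemma Good.congr {c d : (ℕ → ℝ) → ℝ} (hc : Good c) (h : ∀ ρ : ℕ → ℝ, ρ 0 ≠ 0 → d ρ = c ρ) :
    Good d := by
  obtain ⟨P, hP⟩ := hc
  exact ⟨P, fun ρ h0 => (h ρ h0).trans (hP ρ h0)⟩

lemma good_const (x : ℝ) : Good (fun _ => x) := ⟨MvPolynomial.C x, fun ρ _ => by simp⟩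

lemma good_coord (l : ℕ) : Good (fun ρ => ρ l) :=
  ⟨MvPolynomial.X (some l), fun ρ _ => by simp [Vv]⟩

lemma good_inv : Good (fun ρ => (ρ 0)⁻¹) := ⟨MvPolynomial.X none, fun ρ _ => by simp [Vv]⟩

lemma Good.add {c d : (ℕ → ℝ) → ℝ} (hc : Good c) (hd : Good d) : Good (fun ρ => c ρ + d ρ) := by
  obtain ⟨P, hP⟩ := hc
  obtain ⟨Q, hQ⟩ := hd
  exact ⟨P + Q, fun ρ h0 => by simp [hP ρ h0, hQ ρ h0]⟩

lemma Good.mul {c d : (ℕ → ℝ) → ℝ} (hc : Good c) (hd : Good d) : Good (fun ρ => c ρ * d ρ) := by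
  obtain ⟨P, hP⟩ := hc
  obtain ⟨Q, hQ⟩ := hd
  exact ⟨P * Q, fun ρ h0 => by simp [hP ρ h0, hQ ρ h0]⟩

lemma Good.neg {c : (ℕ → ℝ) → ℝ} (hc : Good c) : Good (fun ρ => -c ρ) :=
  ((good_const (-1)).mul hc).congr fun ρ _ => by ring

lemma Good.pow {c : (ℕ → ℝ) → ℝ} (hc : Good c) (n : ℕ) : Good (fun ρ => c ρ ^ n) := by
  obtain ⟨P, hP⟩ := hc
  exact ⟨P ^ n, fun ρ h0 => by simp [hP ρ h0]⟩

lemma good_sum {ι : Type*} (s : Finset ι) {c : ι → (ℕ → ℝ) → ℝ} (hc : ∀ i ∈ s, Good (c i)) :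
    Good (fun ρ => ∑ i ∈ s, c i ρ) := by
  classical
  induction s using Finset.induction_on with
  | empty => simpa using good_const 0
  | insert i s his ih =>
    refine ((hc i (by simp)).add (ih fun j hj => hc j (by simp [hj]))).congr fun ρ _ => ?_
    rw [Finset.sum_insert his]

lemma good_prod {ι : Type*} (s : Finset ι) {c : ι → (ℕ → ℝ) → ℝ} (hc : ∀ i ∈ s, Good (c i)) :
    Good (fun ρ => ∏ i ∈ s, c i ρ) := by
  classical
  induction s using Finset.induction_on with
  | empty => simpa using good_const 1
  | insert i s his ih =>
    refine ((hc i (by simp)).mul (ih fun j hj => hc j (by simp [hj]))).congr fun ρ _ => ?_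
    rw [Finset.prod_insert his]

lemma good_ite (p : Prop) [Decidable p] {c d : (ℕ → ℝ) → ℝ} (hc : p → Good c) (hd : ¬ p → Good d) :
    Good (fun ρ => if p then c ρ else d ρ) := by
  by_cases h : p
  · simpa [h] using hc h
  · simpa [h] using hd h

/-- Derivation on polynomials corresponding to `∂/∂ϱ_l`. -/
def Dd (l : ℕ) (P : MvPolynomial (Option ℕ) ℝ) : MvPolynomial (Option ℕ) ℝ :=
  MvPolynomial.pderiv (some l) P +
    (if l = 0 then -(MvPolynomial.X none ^ 2) else 0) * MvPolynomial.pderiv none P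

lemma hasDerivAt_eval (P : MvPolynomial (Option ℕ) ℝ) (l : ℕ) (ρ : ℕ → ℝ) (h0 : ρ 0 ≠ 0) :
    HasDerivAt (fun t => MvPolynomial.eval (Vv (Function.update ρ l t)) P)
      (MvPolynomial.eval (Vv ρ) (Dd l P)) (ρ l) := by
  induction P using MvPolynomial.induction_on with
  | C x => simpa [Dd] using hasDerivAt_const (ρ l) x
  | add P Q hP hQ =>
    have := hP.add hQ
    have e : MvPolynomial.eval (Vv ρ) (Dd l (P + Q))
        = MvPolynomial.eval (Vv ρ) (Dd l P) + MvPolynomial.eval (Vv ρ) (Dd l Q) := by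
      simp only [Dd, map_add, map_mul]; ring
    rw [e]
    refine this.congr_of_eventuallyEq (Filter.Eventually.of_forall fun t => ?_)
    simp
  | mul_X P o hP =>
    have hX : HasDerivAt (fun t => Vv (Function.update ρ l t) o)
        (MvPolynomial.eval (Vv ρ) (Dd l (MvPolynomial.X o))) (ρ l) := by
      rcases o with _ | k
      · by_cases hl : l = 0
        · subst hl
          have := hasDerivAt_inv h0
          simpa [Dd, Vv, MvPolynomial.pderiv_X, Pi.single_apply] using this
        · have : HasDerivAt (fun _ : ℝ => (ρ 0)⁻¹) 0 (ρ l) := hasDerivAt_const _ _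
          have e : ∀ t, Function.update ρ l t 0 = ρ 0 := fun t =>
            Function.update_of_ne (Ne.symm hl) _ _
          simpa [Dd, Vv, MvPolynomial.pderiv_X, Pi.single_apply, hl, e] using this
      · by_cases hk : k = l
        · subst hk
          simpa [Dd, Vv, MvPolynomial.pderiv_X, Pi.single_apply] using hasDerivAt_id' (ρ k)
        · have : HasDerivAt (fun _ : ℝ => ρ k) 0 (ρ l) := hasDerivAt_const _ _
          have e : ∀ t, Function.update ρ l t k = ρ k := fun t => Function.update_of_ne hk _ _
          simpa [Dd, Vv, MvPolynomial.pderiv_X, Pi.single_apply, hk, e] using this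
    have := hP.mul hX
    rw [Function.update_eq_self] at this
    have e : MvPolynomial.eval (Vv ρ) (Dd l (P * MvPolynomial.X o))
        = MvPolynomial.eval (Vv ρ) (Dd l P) * Vv ρ o
          + MvPolynomial.eval (Vv ρ) P * MvPolynomial.eval (Vv ρ) (Dd l (MvPolynomial.X o)) := by
      simp only [Dd, Derivation.leibniz, map_add, map_mul, smul_eq_mul, MvPolynomial.eval_X]
      ring
    rw [e]
    refine this.congr_of_eventuallyEq (Filter.Eventually.of_forall fun t => ?_)
    simp

lemma eventually_update (ρ : ℕ → ℝ) (l : ℕ) (h0 : ρ 0 ≠ 0) :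
    ∀ᶠ t in nhds (ρ l), Function.update ρ l t 0 ≠ 0 := by
  by_cases hl : l = 0
  · subst hl
    simp only [Function.update_self]
    exact isOpen_ne.mem_nhds h0
  · refine Filter.Eventually.of_forall fun t => ?_
    rwa [Function.update_of_ne (Ne.symm hl)]

lemma hasDerivAt_of_poly {c : (ℕ → ℝ) → ℝ} {P : MvPolynomial (Option ℕ) ℝ}
    (hP : ∀ ρ : ℕ → ℝ, ρ 0 ≠ 0 → c ρ = MvPolynomial.eval (Vv ρ) P)
    (l : ℕ) (ρ : ℕ → ℝ) (h0 : ρ 0 ≠ 0) :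
    HasDerivAt (fun t => c (Function.update ρ l t)) (MvPolynomial.eval (Vv ρ) (Dd l P)) (ρ l) := by
  refine (hasDerivAt_eval P l ρ h0).congr_of_eventuallyEq ?_
  filter_upwards [eventually_update ρ l h0] with t ht
  exact hP _ ht

lemma Good.hasDerivAt {c : (ℕ → ℝ) → ℝ} (hc : Good c) (l : ℕ) (ρ : ℕ → ℝ) (h0 : ρ 0 ≠ 0) :
    HasDerivAt (fun t => c (Function.update ρ l t)) (pdR c l ρ) (ρ l) := by
  obtain ⟨P, hP⟩ := hc
  have := hasDerivAt_of_poly hP l ρ h0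
  unfold pdR
  rwa [this.deriv]

lemma Good.pdR {c : (ℕ → ℝ) → ℝ} (hc : Good c) (l : ℕ) : Good (NCQFT.pdR c l) := by
  obtain ⟨P, hP⟩ := hc
  exact ⟨Dd l P, fun ρ h0 => (hasDerivAt_of_poly hP l ρ h0).deriv⟩

lemma Good.pdR_eq_zero {c : (ℕ → ℝ) → ℝ} (hc : Good c) :
    ∃ L : ℕ, ∀ l, L ≤ l → ∀ ρ : ℕ → ℝ, ρ 0 ≠ 0 → NCQFT.pdR c l ρ = 0 := by
  obtain ⟨P, hP⟩ := hc
  refine ⟨(P.vars.sup fun o => o.getD 0) + 1, fun l hl ρ h0 => ?_⟩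
  have h1 : NCQFT.pdR c l ρ = _ := (hasDerivAt_of_poly hP l ρ h0).deriv
  rw [h1]
  have h2 : some l ∉ P.vars := by
    intro h
    have := Finset.le_sup (f := fun o : Option ℕ => o.getD 0) h
    simp only [Option.getD_some] at this
    omega
  have h3 : l ≠ 0 := by omega
  simp [Dd, h3, MvPolynomial.pderiv_eq_zero_of_notMem_vars h2]

lemma pdR_zero_of_zero {c : (ℕ → ℝ) → ℝ} (hc : ∀ ρ : ℕ → ℝ, ρ 0 ≠ 0 → c ρ = 0) (l : ℕ)
    (ρ : ℕ → ℝ) (h0 : ρ 0 ≠ 0) : NCQFT.pdR c l ρ = 0 := by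
  have h := hasDerivAt_of_poly (c := c) (P := 0) (fun ρ h => by simp [hc ρ h]) l ρ h0
  have h1 : NCQFT.pdR c l ρ = _ := h.deriv
  rw [h1]; simp [Dd]

lemma good_Sm (m : ℕ) : Good (fun ρ => Sm ρ m) := by
  unfold Sm bellP
  refine good_sum _ fun i _ => ?_
  refine ((good_const _).mul (good_inv.pow i)).mul (good_sum _ fun j _ => ?_)
  refine good_ite _ (fun _ => ?_) fun _ => good_const 0
  refine (good_const _).mul (good_prod _ fun i _ => Good.pow ?_ _)
  exact (((good_const _).mul (good_coord _)).mul (good_const _)).congr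
    fun ρ _ => by rw [div_eq_mul_inv]

/-- A finite family of coefficient functions. -/
def Inv (f : ℕ → (ℕ → ℝ) → ℝ) : Prop :=
  (∀ k, Good (f k)) ∧ ∃ K : ℕ, ∀ k, K ≤ k → ∀ ρ : ℕ → ℝ, ρ 0 ≠ 0 → f k ρ = 0

lemma inv_zero : Inv (fun _ _ => 0) := ⟨fun _ => good_const 0, 0, fun _ _ _ _ => rfl⟩

lemma Inv.bound {f : ℕ → (ℕ → ℝ) → ℝ} (hf : Inv f) :
    ∃ K : ℕ, (∀ k, K ≤ k → ∀ ρ : ℕ → ℝ, ρ 0 ≠ 0 → f k ρ = 0) ∧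
      (∀ k, K ≤ k → ∀ l, ∀ ρ : ℕ → ℝ, ρ 0 ≠ 0 → pdR (f k) l ρ = 0) ∧
      (∀ k l, K ≤ l → ∀ ρ : ℕ → ℝ, ρ 0 ≠ 0 → pdR (f k) l ρ = 0) := by
  obtain ⟨hg, K, hK⟩ := hf
  choose L hL using fun k => (hg k).pdR_eq_zero
  have hz : ∀ k, K ≤ k → ∀ l, ∀ ρ : ℕ → ℝ, ρ 0 ≠ 0 → pdR (f k) l ρ = 0 :=
    fun k hk l ρ h0 => pdR_zero_of_zero (hK k hk) l ρ h0
  refine ⟨max K ((Finset.range K).sup L), ?_, ?_, ?_⟩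
  · intro k hk; exact hK k ((le_max_left _ _).trans hk)
  · intro k hk; exact hz k ((le_max_left _ _).trans hk)
  · intro k l hl ρ h0
    by_cases hk : K ≤ k
    · exact hz k hk l ρ h0
    · refine hL k l ?_ ρ h0
      exact (Finset.le_sup (f := L) (Finset.mem_range.2 (not_le.1 hk))).trans
        ((le_max_right _ _).trans hl)

lemma inv_eBr (lam : ℝ) (g : ℕ) (prev : ℕ → ℕ → (ℕ → ℝ) → ℝ) (hp : ∀ h, Inv (prev h)) :
    Inv (eBr lam g prev) := by
  choose B hB1 hB2 hB3 using fun h => (hp h).bound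
  constructor
  · intro m
    unfold eBr
    refine Good.add ?_ ((good_const _).mul (Good.add (Good.add ?_ ?_) ?_))
    · refine good_sum _ fun h _ => good_sum _ fun i _ => good_sum _ fun j _ => ?_
      exact good_ite _ (fun _ => ((hp _).1 _).mul ((hp _).1 _)) fun _ => good_const 0
    · refine good_ite _ (fun _ => ?_) fun _ => good_const 0
      have : Good (fun ρ => -(ρ 0)⁻¹ * ∑ l ∈ Finset.range (B (g - 1)),
          (3 + 2 * (l : ℝ)) * ρ (l + 1) * pdR (prev (g - 1) (m - 2)) l ρ) := by
        refine good_inv.neg.mul (good_sum _ fun l _ => ?_)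
        exact ((good_const _).mul (good_coord _)).mul (((hp _).1 _).pdR l)
      refine this.congr fun ρ h0 => ?_
      rw [tsum_eq_sum (s := Finset.range (B (g - 1))), one_div]
      intro l hl
      rw [hB3 _ _ l (by simpa using hl) ρ h0, mul_zero]
    · refine good_sum _ fun k _ => good_sum _ fun l _ => ?_
      exact good_ite _ (fun _ => (good_const _).mul (((hp _).1 _).pdR l)) fun _ => good_const 0
    · refine good_ite _ (fun _ => ?_) fun _ => good_const 0
      exact (((good_const _).mul ((hp _).1 _)).neg.mul good_inv).congr
        fun ρ _ => by rw [div_eq_mul_inv]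
  · set M := (Finset.range (g + 1)).sup B with hM
    have hBM : ∀ h, h ≤ g → B h ≤ M := fun h hh =>
      Finset.le_sup (f := B) (Finset.mem_range.2 (Nat.lt_succ_of_le hh))
    refine ⟨2 * M + 3, fun m hm ρ h0 => ?_⟩
    have hBg := hBM (g - 1) (by omega)
    unfold eBr
    have t1 : (∑ h ∈ Finset.Icc 1 (g - 1), ∑ i ∈ Finset.range (m + 1), ∑ j ∈ Finset.range (m + 1),
      if i + j + 2 = m then prev h i ρ * prev (g - h) j ρ else 0) = 0 := by
      refine Finset.sum_eq_zero fun h hh => Finset.sum_eq_zero fun i _ =>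
        Finset.sum_eq_zero fun j _ => ?_
      rw [Finset.mem_Icc] at hh
      split_ifs with hij
      · by_cases hi : M ≤ i
        · rw [hB1 h i ((hBM h (by omega)).trans hi) ρ h0, zero_mul]
        · rw [hB1 (g - h) j ((hBM (g - h) (by omega)).trans (by omega)) ρ h0, mul_zero]
      · rfl
    have t3 : (∑ k ∈ Finset.range (m + 1), ∑ l ∈ Finset.range (m + 1),
        if k + l + 3 = m then (3 + 2 * (l : ℝ)) * pdR (prev (g - 1) k) l ρ else 0) = 0 := by
      refine Finset.sum_eq_zero fun i _ => Finset.sum_eq_zero fun j _ => ?_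
      split_ifs with hij
      · by_cases hi : M ≤ i
        · rw [hB2 (g - 1) i (hBg.trans hi) j ρ h0, mul_zero]
        · rw [hB3 (g - 1) i j (hBg.trans (by omega)) ρ h0, mul_zero]
      · rfl
    have t2 : ∀ l, pdR (prev (g - 1) (m - 2)) l ρ = 0 := fun l =>
      hB2 (g - 1) _ (hBg.trans (by omega)) l ρ h0
    rw [t1, t3, hB1 (g - 1) (m - 3) (hBg.trans (by omega)) ρ h0]
    simp [t2]

lemma inv_step (e : ℕ → (ℕ → ℝ) → ℝ) (he : Inv e) :
    Inv (fun k ρ => -(1 / (2 * ρ 0)) * ∑' j : ℕ, e (k + j) ρ * Sm ρ j / (j.factorial : ℝ)) := by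
  obtain ⟨hg, K, hK⟩ := he
  constructor
  · intro k
    have : Good (fun ρ => (-(1 / 2 : ℝ)) * (ρ 0)⁻¹ * ∑ j ∈ Finset.range K,
        e (k + j) ρ * Sm ρ j * (j.factorial : ℝ)⁻¹) := by
      refine ((good_const _).mul good_inv).mul (good_sum _ fun j _ => ?_)
      exact ((hg _).mul (good_Sm j)).mul (good_const _)
    refine this.congr fun ρ h0 => ?_
    beta_reduce
    rw [tsum_eq_sum (s := Finset.range K)]
    · simp only [div_eq_mul_inv, mul_inv]; ring
    · intro j hj
      rw [Finset.mem_range, not_lt] at hj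
      rw [hK (k + j) (by omega) ρ h0]; simp
  · refine ⟨K, fun k hk ρ h0 => ?_⟩
    have : ∀ j, e (k + j) ρ = 0 := fun j => hK _ (by omega) ρ h0
    simp [this]

lemma inv_Gtab (lam : ℝ) (G : ℕ) : ∀ h, Inv (Gtab lam G h) := by
  induction G using Nat.strong_induction_on with
  | _ G ih =>
    intro h
    match G, ih with
    | 0, _ => exact inv_zero
    | 1, _ =>
      by_cases hh : h = 1
      · constructor
        · intro k
          simp only [Gtab, hh, if_true]
          refine good_ite _ (fun _ => ?_) fun _ => good_ite _ (fun _ => ?_) fun _ => good_const 0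
          · exact (((good_const _).mul (good_coord 1)).mul (good_inv.pow 2)).congr
              fun ρ _ => by rw [div_eq_mul_inv, inv_pow]
          · exact ((good_const _).mul good_inv).congr fun ρ _ => by rw [div_eq_mul_inv]
        · refine ⟨2, fun k hk ρ _ => ?_⟩
          simp only [Gtab, hh, if_true]
          rw [if_neg (by omega), if_neg (by omega)]
      · have : Gtab lam 1 h = fun _ _ => 0 := by
          funext k ρ; simp [Gtab, hh]
        rw [this]; exact inv_zero
    | (G + 2), ih =>
      by_cases h1 : h ≤ G + 1
      · have : Gtab lam (G + 2) h = Gtab lam (G + 1) h := by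
          funext k ρ; simp [Gtab, h1]
        rw [this]; exact ih (G + 1) (by omega) h
      · by_cases h2 : h = G + 2
        · have : Gtab lam (G + 2) h = fun k ρ => -(1 / (2 * ρ 0)) *
            ∑' j : ℕ, eBr lam (G + 2) (Gtab lam (G + 1)) (k + j) ρ * Sm ρ j / (j.factorial : ℝ) := by
            funext k ρ; simp [Gtab, h2]
          rw [this]
          exact inv_step _ (inv_eBr lam _ _ (ih (G + 1) (by omega)))
        · have : Gtab lam (G + 2) h = fun _ _ => 0 := by
            funext k ρ; simp [Gtab, h1, h2]
          rw [this]; exact inv_zero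

lemma Gtab_eq (lam : ℝ) (G h : ℕ) (hh : h ≤ G) (hG : 1 ≤ G) (h1 : 1 ≤ h) :
    Gtab lam G h = Gcoef lam h := by
  induction G, (h1.trans hh) using Nat.le_induction with
  | base => obtain rfl : h = 1 := by omega
            rfl
  | succ G hG1 ih =>
    obtain ⟨G, rfl⟩ : ∃ G', G = G' + 1 := ⟨G - 1, by omega⟩
    rcases Nat.lt_or_ge h (G + 2) with h2 | h2
    · rw [← ih (by omega) (by omega)]
      funext k ρ
      have : h ≤ G + 1 := by omega
      simp [Gtab, this]
    · obtain rfl : h = G + 2 := by omega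
      rfl

lemma inv_Gcoef (lam : ℝ) (g : ℕ) : Inv (Gcoef lam g) := inv_Gtab lam g g

/-! ### The operator `K̂` on Laurent polynomials. -/

lemma kernel_identity (z y : ℂ) (hz : z ≠ 0) (hy : y ≠ 0) (h1 : z + y ≠ 0) (h2 : z - y ≠ 0)
    (k : ℕ) :
    1 / z ^ (2 * k + 3) * (1 / ((z + y) * y))
      + (1 / z ^ (2 * k + 3) - 1 / y ^ (2 * k + 3)) / (z ^ 2 - y ^ 2)
      = -∑ i ∈ Finset.range (k + 1), 1 / z ^ (2 * (i + 1)) * (1 / y ^ (3 + 2 * (k - i))) := by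
  have h3 : z ^ 2 - y ^ 2 ≠ 0 := by
    have : z ^ 2 - y ^ 2 = (z + y) * (z - y) := by ring
    rw [this]; exact mul_ne_zero h1 h2
  induction k with
  | zero =>
    simp
    field_simp
    ring
  | succ k ih =>
    rw [Finset.sum_range_succ]
    have e : ∑ i ∈ Finset.range (k + 1), 1 / z ^ (2 * (i + 1)) * (1 / y ^ (3 + 2 * (k + 1 - i)))
        = (1 / y ^ 2) *
          ∑ i ∈ Finset.range (k + 1), 1 / z ^ (2 * (i + 1)) * (1 / y ^ (3 + 2 * (k - i))) := by
      rw [Finset.mul_sum]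
      refine Finset.sum_congr rfl fun i hi => ?_
      have hi' : i ≤ k := by simpa [Nat.lt_succ_iff] using hi
      have : 3 + 2 * (k + 1 - i) = 2 + (3 + 2 * (k - i)) := by omega
      rw [this, pow_add y 2]
      field_simp
    rw [e, neg_add, ← mul_neg, ← ih]
    have e1 : z ^ (2 * (k + 1) + 3) = z ^ (2 * k) * z ^ 5 := by ring
    have e2 : y ^ (2 * (k + 1) + 3) = y ^ (2 * k) * y ^ 5 := by ring
    have e3 : z ^ (2 * k + 3) = z ^ (2 * k) * z ^ 3 := by ring
    have e4 : y ^ (2 * k + 3) = y ^ (2 * k) * y ^ 3 := by ring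
    have e5 : z ^ (2 * (k + 1 + 1)) = z ^ (2 * k) * z ^ 4 := by ring
    rw [e1, e2, e3, e4, e5]
    simp only [Nat.sub_self, mul_zero, add_zero]
    have hp : z ^ (2 * k) ≠ 0 := pow_ne_zero _ hz
    have hq : y ^ (2 * k) ≠ 0 := pow_ne_zero _ hy
    generalize z ^ (2 * k) = p at *
    generalize y ^ (2 * k) = q at *
    clear ih e e1 e2 e3 e4 e5
    have h4 : z ^ 2 - y ^ 2 = (z + y) * (z - y) := by ring
    rw [h4]
    clear h4 h3
    field_simp
    ring

lemma Khat_eq (a b s nbar : ℝ) (r : ℝ → ℝ) (ha : 0 < a) (hab : a < b)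
    (hr : ContinuousOn r (Set.Icc a b)) (c : ℕ → ℂ) (N : ℕ) (f : ℂ → ℂ)
    (hf : ∀ z, f z = ∑ k ∈ Finset.range N, c k / z ^ (2 * k + 3))
    (z : ℂ) (hz : Admissible a b z) :
    Khat a b s nbar r f z = ∑ k ∈ Finset.range N, c k *
      ∑ i ∈ Finset.range (k + 1), (moment a b s r (k - i) : ℂ) * (1 / z ^ (2 * (i + 1))) := by
  have hu : Set.uIcc a b = Set.Icc a b := Set.uIcc_of_le hab.le
  have hrc : ContinuousOn (fun y : ℝ => (r y : ℂ)) (Set.uIcc a b) := by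
    rw [hu]; exact Complex.continuous_ofReal.comp_continuousOn hr
  have hpos : ∀ y ∈ Set.uIcc a b, (y : ℂ) ≠ 0 := by
    intro y hy
    rw [hu] at hy
    exact_mod_cast (ha.trans_le hy.1).ne'
  have hp : ∀ y ∈ Set.uIcc a b, z + (y : ℂ) ≠ 0 := by
    intro y hy
    rw [hu] at hy
    intro h
    exact (hz.2 y hy).2 (eq_neg_of_add_eq_zero_left h)
  have hm : ∀ y ∈ Set.uIcc a b, z - (y : ℂ) ≠ 0 := by
    intro y hy
    rw [hu] at hy
    exact sub_ne_zero.2 (hz.2 y hy).1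
  have hyc : ContinuousOn (fun y : ℝ => (y : ℂ)) (Set.uIcc a b) :=
    Complex.continuous_ofReal.continuousOn
  have i1 : IntervalIntegrable (fun y : ℝ => (r y : ℂ) / ((z + (y : ℂ)) * (y : ℂ))) volume a b := by
    apply ContinuousOn.intervalIntegrable
    refine hrc.div ((continuousOn_const.add hyc).mul hyc) fun y hy => ?_
    exact mul_ne_zero (hp y hy) (hpos y hy)
  have hfc : ContinuousOn (fun y : ℝ => f (y : ℂ)) (Set.uIcc a b) := by
    simp only [hf]
    refine continuousOn_finsetSum _ fun k _ => ?_
    exact continuousOn_const.div (hyc.pow _) fun y hy => pow_ne_zero _ (hpos y hy)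
  have i2 : IntervalIntegrable
      (fun y : ℝ => (r y : ℂ) * (f z - f (y : ℂ)) / (z ^ 2 - (y : ℂ) ^ 2)) volume a b := by
    apply ContinuousOn.intervalIntegrable
    refine (hrc.mul (continuousOn_const.sub hfc)).div (continuousOn_const.sub (hyc.pow 2))
      fun y hy => ?_
    have : z ^ 2 - (y : ℂ) ^ 2 = (z + y) * (z - y) := by ring
    rw [this]
    exact mul_ne_zero (hp y hy) (hm y hy)
  have i3 : ∀ l : ℕ, IntervalIntegrable (fun y : ℝ => (r y : ℂ) / (y : ℂ) ^ (3 + 2 * l))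
      volume a b := by
    intro l
    apply ContinuousOn.intervalIntegrable
    exact hrc.div (hyc.pow _) fun y hy => pow_ne_zero _ (hpos y hy)
  have key : f z * (∫ y in a..b, (r y : ℂ) / ((z + (y : ℂ)) * (y : ℂ)))
      + (∫ y in a..b, (r y : ℂ) * (f z - f (y : ℂ)) / (z ^ 2 - (y : ℂ) ^ 2))
      = -∑ k ∈ Finset.range N, ∑ i ∈ Finset.range (k + 1), c k * (1 / z ^ (2 * (i + 1))) *
          ∫ y in a..b, (r y : ℂ) / (y : ℂ) ^ (3 + 2 * (k - i)) := by
    rw [← intervalIntegral.integral_const_mul, ← intervalIntegral.integral_add (i1.const_mul _) i2]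
    simp only [← intervalIntegral.integral_const_mul]
    have : ∀ k ∈ Finset.range N, (∑ i ∈ Finset.range (k + 1),
        ∫ y in a..b, c k * (1 / z ^ (2 * (i + 1))) * ((r y : ℂ) / (y : ℂ) ^ (3 + 2 * (k - i))))
        = ∫ y in a..b, ∑ i ∈ Finset.range (k + 1),
          c k * (1 / z ^ (2 * (i + 1))) * ((r y : ℂ) / (y : ℂ) ^ (3 + 2 * (k - i))) := by
      intro k _
      rw [intervalIntegral.integral_finsetSum]
      intro i _
      exact (i3 _).const_mul _
    rw [Finset.sum_congr rfl this, ← intervalIntegral.integral_finsetSum,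
      ← intervalIntegral.integral_neg]
    · refine intervalIntegral.integral_congr fun y hy => ?_
      have hk := kernel_identity z y hz.1 (hpos y hy) (hp y hy) (hm y hy)
      have e : f z * ((r y : ℂ) / ((z + (y : ℂ)) * (y : ℂ)))
          + (r y : ℂ) * (f z - f (y : ℂ)) / (z ^ 2 - (y : ℂ) ^ 2)
          = ∑ k ∈ Finset.range N, (r y : ℂ) * c k * (1 / z ^ (2 * k + 3) * (1 / ((z + y) * y))
      + (1 / z ^ (2 * k + 3) - 1 / (y : ℂ) ^ (2 * k + 3)) / (z ^ 2 - y ^ 2)) := by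
        rw [hf z, hf y, ← Finset.sum_sub_distrib, Finset.sum_mul, Finset.mul_sum, Finset.sum_div,
          ← Finset.sum_add_distrib]
        refine Finset.sum_congr rfl fun k _ => ?_
        ring
      rw [e, ← Finset.sum_neg_distrib]
      refine Finset.sum_congr rfl fun k _ => ?_
      rw [hk k, mul_neg, Finset.mul_sum]
      congr 1
      refine Finset.sum_congr rfl fun i _ => ?_
      ring
    · intro k _
      have := IntervalIntegrable.sum (μ := volume) (a := a) (b := b) (Finset.range (k + 1))
        (f := fun i => fun y : ℝ => c k * (1 / z ^ (2 * (i + 1))) * ((r y : ℂ) / (y : ℂ) ^ (3 + 2 * (k - i))))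
        (fun i _ => (i3 _).const_mul _)
      simpa [Finset.sum_fn] using this
  have hmom : ∀ l, (moment a b s r l : ℂ) = (if l = 0 then (s : ℂ) else 0)
      - (1 / 2) * ∫ y in a..b, (r y : ℂ) / (y : ℂ) ^ (3 + 2 * l) := by
    intro l
    unfold moment
    push_cast
    congr 1
    · split_ifs <;> simp
    · rw [← intervalIntegral.integral_ofReal]
      push_cast
      rfl
  have hRHS : ∑ k ∈ Finset.range N, c k *
      ∑ i ∈ Finset.range (k + 1), (moment a b s r (k - i) : ℂ) * (1 / z ^ (2 * (i + 1)))
      = s * z * f z - (1 / 2) * ∑ k ∈ Finset.range N, ∑ i ∈ Finset.range (k + 1),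
        c k * (1 / z ^ (2 * (i + 1))) *
          ∫ y in a..b, (r y : ℂ) / (y : ℂ) ^ (3 + 2 * (k - i)) := by
    rw [hf z, Finset.mul_sum, Finset.mul_sum, ← Finset.sum_sub_distrib]
    refine Finset.sum_congr rfl fun k _ => ?_
    simp only [hmom, sub_mul, Finset.sum_sub_distrib, mul_sub]
    congr 1
    · rw [Finset.sum_range_succ, Finset.sum_eq_zero]
      · have := hz.1
        simp only [Nat.sub_self, if_true]
        field_simp
        ring
      · intro i hi
        rw [Finset.mem_range] at hi
        rw [if_neg (by omega), zero_mul]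
    · rw [Finset.mul_sum, Finset.mul_sum]
      refine Finset.sum_congr rfl fun i _ => ?_
      ring
  rw [hRHS]
  unfold Khat G0fun
  linear_combination (1 / 2 : ℂ) * key

/-- Inverting the triangular system. -/
lemma invert (ρ : ℕ → ℝ) (h0 : ρ 0 ≠ 0) (e : ℕ → ℝ) (E : ℕ) (he : ∀ m, E ≤ m → e m = 0)
    (q : ℕ → ℂ) :
    ∑ k ∈ Finset.range E,
      ((-(1 / (2 * ρ 0)) * ∑' j : ℕ, e (k + j) * Sm ρ j / (j.factorial : ℝ) : ℝ) : ℂ) *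
        (∑ i ∈ Finset.range (k + 1), (ρ (k - i) : ℂ) * q i)
      = -(1 / 2) * ∑ m ∈ Finset.range E, (e m : ℂ) * q m := by
  have hT : ∀ k, k < E → (∑' j : ℕ, e (k + j) * Sm ρ j / (j.factorial : ℝ))
      = ∑ m ∈ Finset.range E, if k ≤ m then e m * Tm ρ (m - k) else 0 := by
    intro k hk
    rw [tsum_eq_sum (s := Finset.range (E - k))]
    · rw [← Finset.sum_filter]
      refine Finset.sum_bij (fun j _ => k + j) ?_ ?_ ?_ ?_
      · intro j hj; simp at hj ⊢; omega
      · intro j _ j' _ h; simpa using h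
      · intro m hm
        simp at hm
        exact ⟨m - k, by simp; omega, by omega⟩
      · intro j _
        rw [Nat.add_sub_cancel_left, Tm, mul_div_assoc]
    · intro j hj
      rw [Finset.mem_range] at hj
      rw [he _ (by omega)]; simp
  set R : PowerSeries ℂ := PowerSeries.mk fun n => (ρ n : ℂ)
  set T : PowerSeries ℂ := PowerSeries.mk fun n => (Tm ρ n : ℂ)
  set Q : PowerSeries ℂ := PowerSeries.mk q
  have hTR : T * R = PowerSeries.C (ρ 0 : ℂ) := by
    have := congrArg (PowerSeries.map Complex.ofRealHom) (series_mul ρ h0)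
    rw [map_mul] at this
    have hC : (PowerSeries.map Complex.ofRealHom) (PowerSeries.C (ρ 0))
        = PowerSeries.C (ρ 0 : ℂ) := by simp
    rw [hC] at this
    rw [← this]
    congr 1
  have hconv : ∀ k, (∑ i ∈ Finset.range (k + 1), (ρ (k - i) : ℂ) * q i)
      = PowerSeries.coeff k (Q * R) := by
    intro k
    rw [PowerSeries.coeff_mul, Finset.Nat.sum_antidiagonal_eq_sum_range_succ_mk]
    refine Finset.sum_congr rfl fun i _ => ?_
    simp [Q, R, mul_comm]
  have hconv2 : ∀ m, (∑ k ∈ Finset.range (m + 1), PowerSeries.coeff k (Q * R) * (Tm ρ (m - k) : ℂ))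
      = (ρ 0 : ℂ) * q m := by
    intro m
    have : PowerSeries.coeff m ((Q * R) * T) = (ρ 0 : ℂ) * q m := by
      rw [mul_assoc, mul_comm R T, hTR, mul_comm, PowerSeries.coeff_C_mul]
      simp [Q]
    rw [← this, PowerSeries.coeff_mul, Finset.Nat.sum_antidiagonal_eq_sum_range_succ_mk]
    refine Finset.sum_congr rfl fun i _ => ?_
    simp [T]
  have hc0 : (ρ 0 : ℂ) ≠ 0 := by exact_mod_cast h0
  calc _ = ∑ k ∈ Finset.range E, ∑ m ∈ Finset.range E, (-(1 / (2 * (ρ 0 : ℂ)))) *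
        (if k ≤ m then (e m : ℂ) * (PowerSeries.coeff k (Q * R) * (Tm ρ (m - k) : ℂ)) else 0) := by
        refine Finset.sum_congr rfl fun k hk => ?_
        rw [hT k (Finset.mem_range.1 hk), hconv]
        push_cast
        rw [Finset.mul_sum, Finset.sum_mul]
        refine Finset.sum_congr rfl fun m _ => ?_
        split_ifs
        · push_cast; ring
        · simp
    _ = ∑ m ∈ Finset.range E, (-(1 / (2 * (ρ 0 : ℂ)))) * ((e m : ℂ) * ((ρ 0 : ℂ) * q m)) := by
        rw [Finset.sum_comm]
        refine Finset.sum_congr rfl fun m hm => ?_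
        rw [← Finset.mul_sum, ← hconv2 m]
        congr 1
        rw [Finset.mul_sum, ← Finset.sum_filter]
        refine Finset.sum_congr ?_ fun _ _ => rfl
        ext k
        simp at hm ⊢
        omega
    _ = _ := by
        rw [Finset.mul_sum]
        refine Finset.sum_congr rfl fun m _ => ?_
        field_simp

lemma conv_sum (φ : ℕ → ℕ → ℂ) (Q : ℕ → ℂ) (K d E : ℕ) (hE : 2 * K + d ≤ E)
    (h1 : ∀ i j, K ≤ i → φ i j = 0) (h2 : ∀ i j, K ≤ j → φ i j = 0) :
    ∑ m ∈ Finset.range E, (∑ i ∈ Finset.range (m + 1), ∑ j ∈ Finset.range (m + 1),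
      if i + j + d = m then φ i j else 0) * Q m
    = ∑ i ∈ Finset.range K, ∑ j ∈ Finset.range K, φ i j * Q (i + j + d) := by
  have e1 : ∀ m, (∑ i ∈ Finset.range (m + 1), ∑ j ∈ Finset.range (m + 1),
      if i + j + d = m then φ i j else 0)
      = ∑ i ∈ Finset.range K, ∑ j ∈ Finset.range K, if i + j + d = m then φ i j else 0 := by
    intro m
    simp only [← Finset.sum_product']
    have hs : ∀ s : Finset (ℕ × ℕ), (∑ x ∈ s, if x.1 + x.2 + d = m then φ x.1 x.2 else 0)
        = ∑ x ∈ s with (x.1 + x.2 + d = m ∧ φ x.1 x.2 ≠ 0), φ x.1 x.2 := by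
      intro s
      rw [Finset.sum_filter]
      refine Finset.sum_congr rfl fun x _ => ?_
      by_cases hx : φ x.1 x.2 = 0 <;> simp [hx]
    rw [hs, hs]
    refine Finset.sum_congr ?_ fun _ _ => rfl
    ext ⟨i, j⟩
    simp only [Finset.mem_filter, Finset.mem_product, Finset.mem_range]
    constructor
    · rintro ⟨_, h, hne⟩
      refine ⟨⟨?_, ?_⟩, h, hne⟩
      · by_contra hc; exact hne (h1 i j (by omega))
      · by_contra hc; exact hne (h2 i j (by omega))
    · rintro ⟨_, h, hne⟩
      exact ⟨by omega, h, hne⟩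
  simp only [e1, Finset.sum_mul]
  rw [Finset.sum_comm]
  refine Finset.sum_congr rfl fun i hi => ?_
  rw [Finset.sum_comm]
  refine Finset.sum_congr rfl fun j hj => ?_
  rw [Finset.mem_range] at hi hj
  rw [Finset.sum_eq_single (i + j + d)]
  · simp
  · intro m _ hm
    rw [if_neg (Ne.symm hm), zero_mul]
  · intro h
    exact absurd (Finset.mem_range.2 (by omega)) h

lemma shift_sum (φ : ℕ → ℂ) (Q : ℕ → ℂ) (K d E : ℕ) (hE : K + d ≤ E)
    (h1 : ∀ i, K ≤ i → φ i = 0) :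
    ∑ m ∈ Finset.range E, (if d ≤ m then φ (m - d) else 0) * Q m
    = ∑ i ∈ Finset.range K, φ i * Q (i + d) := by
  have : ∑ i ∈ Finset.range K, φ i * Q (i + d) = ∑ i ∈ Finset.range (E - d), φ i * Q (i + d) := by
    refine Finset.sum_subset (fun x hx => ?_) fun x _ hx => ?_
    · simp at hx ⊢; omega
    · rw [h1 x (by simpa using hx), zero_mul]
  rw [this]
  obtain ⟨F, rfl⟩ : ∃ F, E = d + F := ⟨E - d, by omega⟩
  rw [Finset.sum_range_add, Finset.sum_eq_zero, zero_add, Nat.add_sub_cancel_left]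
  · refine Finset.sum_congr rfl fun i _ => ?_
    rw [if_pos (by omega), Nat.add_sub_cancel_left, add_comm]
  · intro i hi
    rw [Finset.mem_range] at hi
    rw [if_neg (by omega), zero_mul]

/-! ### The bracket. -/

/-- `K` bounds the support of the coefficient family and of its derivatives. -/
def Bd (K : ℕ) (f : ℕ → (ℕ → ℝ) → ℝ) : Prop :=
  (∀ k, K ≤ k → ∀ ρ : ℕ → ℝ, ρ 0 ≠ 0 → f k ρ = 0) ∧
      (∀ k, K ≤ k → ∀ l, ∀ ρ : ℕ → ℝ, ρ 0 ≠ 0 → pdR (f k) l ρ = 0) ∧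
      (∀ k l, K ≤ l → ∀ ρ : ℕ → ℝ, ρ 0 ≠ 0 → pdR (f k) l ρ = 0)

lemma Bd.mono {K K' : ℕ} {f : ℕ → (ℕ → ℝ) → ℝ} (h : Bd K f) (hK : K ≤ K') : Bd K' f :=
  ⟨fun k hk => h.1 k (hK.trans hk), fun k hk => h.2.1 k (hK.trans hk),
    fun k l hl => h.2.2 k l (hK.trans hl)⟩

lemma exists_Bd (lam : ℝ) (g : ℕ) : ∃ K, ∀ h, h ≤ g → Bd K (Gcoef lam h) := by
  choose B hB using fun h => (inv_Gcoef lam h).bound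
  refine ⟨(Finset.range (g + 1)).sup B, fun h hh => Bd.mono (hB h) ?_⟩
  exact Finset.le_sup (f := B) (Finset.mem_range.2 (Nat.lt_succ_of_le hh))

lemma Gfun_eq (lam : ℝ) (g K : ℕ) (hK : Bd K (Gcoef lam g)) (ρ : ℕ → ℝ) (h0 : ρ 0 ≠ 0) (z : ℂ) :
    Gfun lam g ρ z = ∑ k ∈ Finset.range K, (Gcoef lam g k ρ : ℂ) / z ^ (2 * k + 3) := by
  unfold Gfun
  rw [tsum_eq_sum]
  intro k hk
  rw [hK.1 k (by simpa using hk) ρ h0]; simp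

lemma pdC_Gfun (lam : ℝ) (g K : ℕ) (hK : Bd K (Gcoef lam g)) (ρ : ℕ → ℝ) (h0 : ρ 0 ≠ 0) (z : ℂ)
    (l : ℕ) :
    pdC (fun σ => Gfun lam g σ z) l ρ
      = ∑ k ∈ Finset.range K, (pdR (Gcoef lam g k) l ρ : ℂ) / z ^ (2 * k + 3) := by
  unfold pdC
  have h : HasDerivAt (fun t : ℝ => ∑ k ∈ Finset.range K,
      (Gcoef lam g k (Function.update ρ l t) : ℂ) / z ^ (2 * k + 3))
      (∑ k ∈ Finset.range K, (pdR (Gcoef lam g k) l ρ : ℂ) / z ^ (2 * k + 3)) (ρ l) := by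
    refine HasDerivAt.fun_sum fun k _ => ?_
    exact ((((inv_Gcoef lam g).1 k).hasDerivAt l ρ h0).ofReal_comp).div_const _
  refine (h.congr_of_eventuallyEq ?_).deriv
  filter_upwards [eventually_update ρ l h0] with t ht
  exact Gfun_eq lam g K hK _ ht z

lemma deriv_Gfun (lam : ℝ) (g K : ℕ) (hK : Bd K (Gcoef lam g)) (ρ : ℕ → ℝ) (h0 : ρ 0 ≠ 0) (z : ℂ)
    (hz : z ≠ 0) :
    deriv (Gfun lam g ρ) z
      = ∑ k ∈ Finset.range K, -(((2 * k + 3 : ℕ) : ℂ) * (Gcoef lam g k ρ : ℂ)) / z ^ (2 * k + 4) := by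
  have : Gfun lam g ρ = fun w => ∑ k ∈ Finset.range K, (Gcoef lam g k ρ : ℂ) / w ^ (2 * k + 3) :=
    funext fun w => Gfun_eq lam g K hK ρ h0 w
  rw [this]
  refine HasDerivAt.deriv (HasDerivAt.fun_sum fun k _ => ?_)
  have h := ((hasDerivAt_pow (2 * k + 3) z).fun_inv (pow_ne_zero _ hz)).const_mul
    (Gcoef lam g k ρ : ℂ)
  simp only [← div_eq_mul_inv] at h
  refine h.congr_deriv ?_
  have e1 : 2 * k + 3 - 1 = 2 * k + 2 := by omega
  rw [e1]
  have e2 : z ^ (2 * k + 4) = z ^ (2 * k + 2) * z ^ 2 := by ring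
  have e3 : z ^ (2 * k + 3) = z ^ (2 * k + 2) * z := by ring
  have hp : z ^ (2 * k + 2) ≠ 0 := pow_ne_zero _ hz
  rw [e2, e3]
  generalize z ^ (2 * k + 2) = p at *
  field_simp

lemma Gpair_eq (lam : ℝ) (g K : ℕ) (hg : g ≠ 0) (hK : Bd K (Gcoef lam g)) (ρ : ℕ → ℝ)
    (h0 : ρ 0 ≠ 0) (z : ℂ) (hz : z ≠ 0) :
    Gpair lam g ρ z = (2 * (lam : ℂ)) ^ 2 *
      ((∑ l ∈ Finset.range K, (-((3 + 2 * (l : ℂ)) * (ρ (l + 1) : ℂ)) / ((ρ 0 : ℂ) * z ^ 3)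
        + (3 + 2 * (l : ℂ)) / z ^ (5 + 2 * l)) *
          ∑ k ∈ Finset.range K, (pdR (Gcoef lam g k) l ρ : ℂ) / z ^ (2 * k + 3))
     + (1 / ((ρ 0 : ℂ) * z ^ 4)) *
      ∑ k ∈ Finset.range K, -(((2 * k + 3 : ℕ) : ℂ) * (Gcoef lam g k ρ : ℂ)) / z ^ (2 * k + 4)) := by
  unfold Gpair
  rw [if_neg hg, deriv_Gfun lam g K hK ρ h0 z hz, tsum_eq_sum (s := Finset.range K)]
  · simp only [pdC_Gfun lam g K hK ρ h0 z]
  · intro l hl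
    rw [pdC_Gfun lam g K hK ρ h0 z, Finset.sum_eq_zero, mul_zero]
    intro k _
    rw [hK.2.2 k l (by simpa using hl) ρ h0]; simp

lemma eBr_Gtab (lam : ℝ) (G : ℕ) :
    eBr lam (G + 2) (Gtab lam (G + 1)) = eBr lam (G + 2) (Gcoef lam) := by
  funext m ρ
  have e1 : Gtab lam (G + 1) (G + 2 - 1) = Gcoef lam (G + 2 - 1) :=
    Gtab_eq lam _ _ (by omega) (by omega) (by omega)
  unfold eBr
  rw [e1]
  congr 1
  refine Finset.sum_congr rfl fun h hh => ?_
  rw [Finset.mem_Icc] at hh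
  rw [Gtab_eq lam (G + 1) h (by omega) (by omega) (by omega),
    Gtab_eq lam (G + 1) (G + 2 - h) (by omega) (by omega) (by omega)]

lemma bracket (lam : ℝ) (g K E : ℕ) (hg : 2 ≤ g) (hK : ∀ h, h ≤ g → Bd K (Gcoef lam h))
    (hE : 2 * K + 3 ≤ E) (ρ : ℕ → ℝ) (h0 : ρ 0 ≠ 0) (z : ℂ) (hz : z ≠ 0) :
    ∑ m ∈ Finset.range E, (eBr lam g (Gcoef lam) m ρ : ℂ) * (1 / z ^ (2 * (m + 1)))
      = (∑ h ∈ Finset.Icc 1 (g - 1), Gfun lam h ρ z * Gfun lam (g - h) ρ z)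
        + (2 * (lam : ℂ)) ^ 2 * Gpair lam (g - 1) ρ z := by
  have hc0 : (ρ 0 : ℂ) ≠ 0 := by exact_mod_cast h0
  have hKg := hK (g - 1) (by omega)
  -- quadratic part
  have A1 : ∀ h ∈ Finset.Icc 1 (g - 1), Gfun lam h ρ z * Gfun lam (g - h) ρ z
      = ∑ m ∈ Finset.range E, (∑ i ∈ Finset.range (m + 1), ∑ j ∈ Finset.range (m + 1),
        if i + j + 2 = m then (Gcoef lam h i ρ : ℂ) * (Gcoef lam (g - h) j ρ : ℂ) else 0)
          * (1 / z ^ (2 * (m + 1))) := by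
    intro h hh
    rw [Finset.mem_Icc] at hh
    have b1 := hK h (by omega)
    have b2 := hK (g - h) (by omega)
    rw [conv_sum (fun i j => (Gcoef lam h i ρ : ℂ) * (Gcoef lam (g - h) j ρ : ℂ))
      (fun m => 1 / z ^ (2 * (m + 1))) K 2 E (by omega)
      (fun i j hi => by rw [b1.1 i hi ρ h0]; simp) (fun i j hj => by rw [b2.1 j hj ρ h0]; simp)]
    rw [Gfun_eq lam h K b1 ρ h0, Gfun_eq lam (g - h) K b2 ρ h0, Finset.sum_mul_sum]
    refine Finset.sum_congr rfl fun i _ => Finset.sum_congr rfl fun j _ => ?_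
    have : z ^ (2 * (i + j + 2 + 1)) = z ^ (2 * i + 3) * z ^ (2 * j + 3) := by
      rw [← pow_add]; congr 1; ring
    rw [this]
    field_simp
  have A3 := conv_sum (fun k l => (3 + 2 * (l : ℂ)) * (pdR (Gcoef lam (g - 1) k) l ρ : ℂ))
      (fun m => 1 / z ^ (2 * (m + 1))) K 3 E (by omega)
      (fun i j hi => by rw [hKg.2.1 i hi j ρ h0]; simp)
      (fun i j hj => by rw [hKg.2.2 i j hj ρ h0]; simp)
  have A2 := shift_sum (fun k => -(1 / (ρ 0 : ℂ)) * ∑ l ∈ Finset.range K,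
        (3 + 2 * (l : ℂ)) * (ρ (l + 1) : ℂ) * (pdR (Gcoef lam (g - 1) k) l ρ : ℂ))
      (fun m => 1 / z ^ (2 * (m + 1))) K 2 E (by omega)
      (fun i hi => by
        rw [Finset.sum_eq_zero, mul_zero]
        intro l _
        rw [hKg.2.1 i hi l ρ h0]; simp)
  have A4 := shift_sum (fun k => -(((2 * k + 3 : ℕ) : ℂ) * (Gcoef lam (g - 1) k ρ : ℂ)) / (ρ 0 : ℂ))
      (fun m => 1 / z ^ (2 * (m + 1))) K 3 E (by omega)
      (fun i hi => by rw [hKg.1 i hi ρ h0]; simp)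
  have hts : ∀ k, (∑' l : ℕ, (3 + 2 * (l : ℝ)) * ρ (l + 1) * pdR (Gcoef lam (g - 1) k) l ρ)
      = ∑ l ∈ Finset.range K, (3 + 2 * (l : ℝ)) * ρ (l + 1) * pdR (Gcoef lam (g - 1) k) l ρ := by
    intro k
    rw [tsum_eq_sum]
    intro l hl
    rw [hKg.2.2 k l (by simpa using hl) ρ h0, mul_zero]
  have hexp : ∀ m, (eBr lam g (Gcoef lam) m ρ : ℂ)
      = (∑ h ∈ Finset.Icc 1 (g - 1), ∑ i ∈ Finset.range (m + 1), ∑ j ∈ Finset.range (m + 1),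
          if i + j + 2 = m then (Gcoef lam h i ρ : ℂ) * (Gcoef lam (g - h) j ρ : ℂ) else 0)
        + (2 * (lam : ℂ)) ^ 4 * (
          (if 2 ≤ m then -(1 / (ρ 0 : ℂ)) * ∑ l ∈ Finset.range K, (3 + 2 * (l : ℂ)) *
            (ρ (l + 1) : ℂ) * (pdR (Gcoef lam (g - 1) (m - 2)) l ρ : ℂ) else 0)
          + (∑ k ∈ Finset.range (m + 1), ∑ l ∈ Finset.range (m + 1),
            if k + l + 3 = m then (3 + 2 * (l : ℂ)) * (pdR (Gcoef lam (g - 1) k) l ρ : ℂ) else 0)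
          + (if 3 ≤ m then -(((2 * (m - 3) + 3 : ℕ) : ℂ) * (Gcoef lam (g - 1) (m - 3) ρ : ℂ))
              / (ρ 0 : ℂ) else 0)) := by
    intro m
    unfold eBr
    rw [hts]
    push_cast [apply_ite Complex.ofReal]
    rfl
  have hsplit : ∀ (P A B C Q : ℕ → ℂ) (κ : ℂ),
      ∑ m ∈ Finset.range E, (P m + κ * (A m + B m + C m)) * Q m
      = ∑ m ∈ Finset.range E, P m * Q m + κ * (∑ m ∈ Finset.range E, A m * Q m
        + ∑ m ∈ Finset.range E, B m * Q m + ∑ m ∈ Finset.range E, C m * Q m) := by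
    intro P A B C Q κ
    rw [← Finset.sum_add_distrib, ← Finset.sum_add_distrib, Finset.mul_sum,
      ← Finset.sum_add_distrib]
    refine Finset.sum_congr rfl fun m _ => ?_
    ring
  have f1 : ∀ k : ℕ, z ^ (2 * (k + 2 + 1)) = z ^ (2 * k + 3) * z ^ 3 := fun k => by
    rw [← pow_add]; congr 1
  have f2 : ∀ k l : ℕ, z ^ (2 * (k + l + 3 + 1)) = z ^ (2 * k + 3) * z ^ (5 + 2 * l) :=
    fun k l => by rw [← pow_add]; congr 1; ring
  have f3 : ∀ k : ℕ, z ^ (2 * (k + 3 + 1)) = z ^ (2 * k + 4) * z ^ 4 := fun k => by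
    rw [← pow_add]; congr 1
  simp only [f1] at A2
  simp only [f2] at A3
  simp only [f3] at A4
  simp only [hexp]
  rw [hsplit, A2, A3, A4]
  congr 1
  · rw [Finset.sum_congr rfl A1, Finset.sum_comm]
    simp only [Finset.sum_mul]
  · rw [Gpair_eq lam (g - 1) K (by omega) hKg ρ h0 z hz]
    have g1 : (∑ l ∈ Finset.range K, (-((3 + 2 * (l : ℂ)) * (ρ (l + 1) : ℂ)) / ((ρ 0 : ℂ) * z ^ 3)
        + (3 + 2 * (l : ℂ)) / z ^ (5 + 2 * l)) *
          ∑ k ∈ Finset.range K, (pdR (Gcoef lam (g - 1) k) l ρ : ℂ) / z ^ (2 * k + 3))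
      = (∑ k ∈ Finset.range K, (-(1 / (ρ 0 : ℂ)) * ∑ l ∈ Finset.range K, (3 + 2 * (l : ℂ)) *
            (ρ (l + 1) : ℂ) * (pdR (Gcoef lam (g - 1) k) l ρ : ℂ)) * (1 / (z ^ (2 * k + 3) * z ^ 3)))
        + ∑ k ∈ Finset.range K, ∑ l ∈ Finset.range K,
          (3 + 2 * (l : ℂ)) * (pdR (Gcoef lam (g - 1) k) l ρ : ℂ) *
            (1 / (z ^ (2 * k + 3) * z ^ (5 + 2 * l))) := by
      rw [← Finset.sum_add_distrib]
      simp only [Finset.mul_sum, Finset.sum_mul, ← Finset.sum_add_distrib]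
      rw [Finset.sum_comm]
      refine Finset.sum_congr rfl fun k _ => Finset.sum_congr rfl fun l _ => ?_
      field_simp
    have g2 : (1 / ((ρ 0 : ℂ) * z ^ 4)) * (∑ k ∈ Finset.range K,
        -(((2 * k + 3 : ℕ) : ℂ) * (Gcoef lam (g - 1) k ρ : ℂ)) / z ^ (2 * k + 4))
      = ∑ k ∈ Finset.range K, -(((2 * k + 3 : ℕ) : ℂ) * (Gcoef lam (g - 1) k ρ : ℂ)) / (ρ 0 : ℂ)
          * (1 / (z ^ (2 * k + 4) * z ^ 4)) := by
      rw [Finset.mul_sum]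
      refine Finset.sum_congr rfl fun k _ => ?_
      field_simp
    rw [g1, g2]
    ring

lemma DS (a b s nbar : ℝ) (r : ℝ → ℝ) (ha : 0 < a) (hab : a < b)
    (hr : ContinuousOn r (Set.Icc a b)) (hρ0 : moment a b s r 0 ≠ 0)
    (lam : ℝ) (g : ℕ) (hg : 1 ≤ g) (z : ℂ) (hz : Admissible a b z) :
      Khat a b s nbar r (Gfun lam g (moment a b s r)) z
        = -(1 / 2) * (∑ h ∈ Finset.Icc 1 (g - 1),
              Gfun lam h (moment a b s r) z * Gfun lam (g - h) (moment a b s r) z)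
          - 2 * (lam : ℂ) ^ 2 * Gpair lam (g - 1) (moment a b s r) z := by
  set ρ := moment a b s r with hρ
  have hc0 : (ρ 0 : ℂ) ≠ 0 := by exact_mod_cast hρ0
  obtain ⟨K, hK⟩ := exists_Bd lam g
  rcases Nat.lt_or_ge g 2 with h2 | h2
  · obtain rfl : g = 1 := by omega
    rw [Khat_eq a b s nbar r ha hab hr (fun k => (Gcoef lam 1 k ρ : ℂ)) 2 _ ?_ z hz]
    · have := hz.1
      simp [Finset.sum_range_succ, Gcoef, Gtab, Gpair, ← hρ]
      field_simp
      ring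
    · intro w
      unfold Gfun
      rw [tsum_eq_sum]
      intro k hk
      simp only [Finset.mem_range, not_lt] at hk
      have h1 : k ≠ 0 := by omega
      have h2 : k ≠ 1 := by omega
      simp [Gcoef, Gtab, h1, h2]
  · obtain ⟨G, rfl⟩ : ∃ G, g = G + 2 := ⟨g - 2, by omega⟩
    obtain ⟨E0, hE0⟩ := (inv_eBr lam (G + 2) (Gcoef lam) (inv_Gcoef lam)).2
    set E := max E0 (2 * K + 3) with hE
    have hEK : 2 * K + 3 ≤ E := le_max_right _ _
    have hcoef : ∀ k, Gcoef lam (G + 2) k ρ = -(1 / (2 * ρ 0)) *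
        ∑' j : ℕ, eBr lam (G + 2) (Gcoef lam) (k + j) ρ * Sm ρ j / (j.factorial : ℝ) := by
      intro k
      rw [← eBr_Gtab]
      simp [Gcoef, Gtab]
    rw [Khat_eq a b s nbar r ha hab hr (fun k => (Gcoef lam (G + 2) k ρ : ℂ)) E _
      (fun w => Gfun_eq lam (G + 2) E ((hK _ le_rfl).mono (by omega)) ρ hρ0 w) z hz]
    simp only [hcoef]
    rw [invert ρ hρ0 (fun m => eBr lam (G + 2) (Gcoef lam) m ρ) E
      (fun m hm => hE0 m ((le_max_left _ _).trans hm) ρ hρ0) (fun i => 1 / z ^ (2 * (i + 1))),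
      bracket lam (G + 2) K E h2 hK hEK ρ hρ0 z hz.1]
    ring

end NCQFT

open NCQFT in
/-- With `ϱ` the moments of the measure: (i) each `𝒢_g(z)` (`g ≥ 1`) is an
odd Laurent polynomial in `z` with only negative odd powers (its coefficient family has
finite support), and (ii) it satisfies the Dyson–Schwinger equation
`K̂𝒢_g(z) = −½Σ_{h=1}^{g−1}𝒢_h(z)𝒢_{g−h}(z) − 2λ²𝒢_{g−1}(z|z)` at admissible `z`. -/
theorem stmt7 (a b s nbar : ℝ) (r : ℝ → ℝ)
    (ha : 0 < a) (hab : a < b)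
    (hr : ContinuousOn r (Set.Icc a b)) (hrpos : ∀ y ∈ Set.Icc a b, 0 ≤ r y)
    (hs : 0 < s) (hρ0 : moment a b s r 0 ≠ 0)
    (lam : ℝ) (hlam : lam ≠ 0) (g : ℕ) (hg : 1 ≤ g) :
    (∃ K : ℕ, ∀ k, K ≤ k → Gcoef lam g k (moment a b s r) = 0) ∧
    (∀ z : ℂ, z ≠ 0 →
      Gfun lam g (moment a b s r) (-z) = -Gfun lam g (moment a b s r) z) ∧
    (∀ z : ℂ, Admissible a b z →
      Khat a b s nbar r (Gfun lam g (moment a b s r)) z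
        = -(1 / 2) * (∑ h ∈ Finset.Icc 1 (g - 1),
              Gfun lam h (moment a b s r) z * Gfun lam (g - h) (moment a b s r) z)
          - 2 * (lam : ℂ) ^ 2 * Gpair lam (g - 1) (moment a b s r) z) := by
  refine ⟨?_, ?_, fun z hz => DS a b s nbar r ha hab hr hρ0 lam g hg z hz⟩
  · obtain ⟨K, hK⟩ := (inv_Gcoef lam g).2
    exact ⟨K, fun k hk => hK k hk _ hρ0⟩
  · intro z _
    unfold Gfun
    rw [← tsum_neg]
    congr 1
    funext k
    have : Odd (2 * k + 3) := ⟨k + 1, by ring⟩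
    rw [this.neg_pow, div_neg]
end
end

section
/- For every g ≥ 1 there exist a rational constant P₀ and, for each 1 ≤ j ≤ 3g−2, a j-weighted polynomial P_j with rational coefficients in the variables ϱ₁/ϱ₀, …, ϱ_j/ϱ₀, such that G_g(z) = (2λ)^{4g}·Σ_{k=0}^{3g−2} P_{3g−2−k}/(ϱ₀^{2g−1}·z^{2k+3}). -/
open scoped BigOperators
open MeasureTheory

noncomputable section

/-! ### Proof: graded class of functions of the moments. -/

namespace NCQFT

/-- Functions of the form `(2λ)^{4r} ϱ₀^{-p} P(ϱ₁/ϱ₀,…)` with `P` rational and `n`-weighted. -/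
inductive WC (lam : ℝ) : ℕ → ℕ → ℤ → ((ℕ → ℝ) → ℝ) → Prop
  | zero (r p : ℕ) (n : ℤ) : WC lam r p n (fun _ => 0)
  | const (q : ℚ) : WC lam 0 0 0 (fun _ => (q : ℝ))
  | lam4 : WC lam 1 0 0 (fun _ => (2 * lam) ^ 4)
  | inv : WC lam 0 1 0 (fun ρ => (ρ 0)⁻¹)
  | var (i : ℕ) : WC lam 0 0 ((i : ℤ) + 1) (fun ρ => ρ (i + 1) / ρ 0)
  | add {r p : ℕ} {n : ℤ} {F H : (ℕ → ℝ) → ℝ} :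
      WC lam r p n F → WC lam r p n H → WC lam r p n (fun ρ => F ρ + H ρ)
  | mul {r p r' p' : ℕ} {n n' : ℤ} {F H : (ℕ → ℝ) → ℝ} :
      WC lam r p n F → WC lam r' p' n' H → WC lam (r + r') (p + p') (n + n') (fun ρ => F ρ * H ρ)
  | congr {r p : ℕ} {n : ℤ} {F H : (ℕ → ℝ) → ℝ} :
      WC lam r p n F → (∀ ρ, ρ 0 ≠ 0 → H ρ = F ρ) → WC lam r p n H

variable {lam : ℝ}

theorem WC.cast {r p r' p' : ℕ} {n n' : ℤ} {F H : (ℕ → ℝ) → ℝ} (h : WC lam r p n F)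
    (hr : r = r') (hp : p = p') (hn : n = n') (e : ∀ ρ, ρ 0 ≠ 0 → H ρ = F ρ) :
    WC lam r' p' n' H := by
  subst hr hp hn
  exact h.congr e

theorem WC.sum {ι : Type*} (s : Finset ι) {r p : ℕ} {n : ℤ} {F : ι → (ℕ → ℝ) → ℝ}
    (h : ∀ i ∈ s, WC lam r p n (F i)) : WC lam r p n (fun ρ => ∑ i ∈ s, F i ρ) := by
  classical
  induction s using Finset.induction_on with
  | empty => simpa using WC.zero r p n
  | insert a s ha ih =>
    simp only [Finset.sum_insert ha]
    exact (h a (by simp)).add (ih fun i hi => h i (by simp [hi]))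

theorem WC.pow {n : ℤ} {F : (ℕ → ℝ) → ℝ} (h : WC lam 0 0 n F) (k : ℕ) :
    WC lam 0 0 (k * n) (fun ρ => F ρ ^ k) := by
  induction k with
  | zero => exact (WC.const 1).cast rfl rfl (by simp) (by simp)
  | succ k ih => exact (ih.mul h).cast rfl rfl (by push_cast; ring) (fun ρ _ => by rw [pow_succ])

theorem WC.prod {ι : Type*} (s : Finset ι) {n : ι → ℤ} {F : ι → (ℕ → ℝ) → ℝ}
    (h : ∀ i ∈ s, WC lam 0 0 (n i) (F i)) :
    WC lam 0 0 (∑ i ∈ s, n i) (fun ρ => ∏ i ∈ s, F i ρ) := by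
  classical
  induction s using Finset.induction_on with
  | empty => simpa using WC.const (lam := lam) 1
  | insert a s ha ih =>
    simp only [Finset.prod_insert ha, Finset.sum_insert ha]
    exact (h a (by simp)).mul (ih fun i hi => h i (by simp [hi]))

theorem WC.smul {r p : ℕ} {n : ℤ} {F : (ℕ → ℝ) → ℝ} (h : WC lam r p n F) (q : ℚ) :
    WC lam r p n (fun ρ => (q : ℝ) * F ρ) :=
  ((WC.const q).mul h).cast (by simp) (by simp) (by simp) (fun _ _ => rfl)

theorem WC.ite {r p : ℕ} {n : ℤ} {F : (ℕ → ℝ) → ℝ} (c : Prop) [Decidable c]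
    (h : c → WC lam r p n F) : WC lam r p n (fun ρ => if c then F ρ else 0) := by
  by_cases hc : c
  · simpa [hc] using h hc
  · simpa [hc] using WC.zero r p n

/-- Polynomial normal form. -/
theorem WC.poly {r p : ℕ} {n : ℤ} {F : (ℕ → ℝ) → ℝ} (h : WC lam r p n F) :
    ∃ P : MvPolynomial ℕ ℚ,
      MvPolynomial.IsWeightedHomogeneous (fun i : ℕ => (i : ℤ) + 1) P n ∧
      ∀ ρ : ℕ → ℝ, ρ 0 ≠ 0 →
        F ρ = (2 * lam) ^ (4 * r) *
          (MvPolynomial.aeval (fun i : ℕ => ρ (i + 1) / ρ 0) P : ℝ) / ρ 0 ^ p := by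
  induction h with
  | zero r p n => exact ⟨0, MvPolynomial.isWeightedHomogeneous_zero _ _ _, by simp⟩
  | const q => exact ⟨MvPolynomial.C q, MvPolynomial.isWeightedHomogeneous_C _ _, by simp⟩
  | lam4 => exact ⟨1, MvPolynomial.isWeightedHomogeneous_one _ _, by simp⟩
  | inv => exact ⟨1, MvPolynomial.isWeightedHomogeneous_one _ _, by simp⟩
  | var i => exact ⟨MvPolynomial.X i, MvPolynomial.isWeightedHomogeneous_X _ _ _, by simp⟩
  | add _ _ ih1 ih2 =>
    obtain ⟨P, hP, eP⟩ := ih1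
    obtain ⟨Q, hQ, eQ⟩ := ih2
    refine ⟨P + Q, hP.add hQ, fun ρ hρ => ?_⟩
    beta_reduce
    rw [eP ρ hρ, eQ ρ hρ, map_add]; ring
  | mul _ _ ih1 ih2 =>
    obtain ⟨P, hP, eP⟩ := ih1
    obtain ⟨Q, hQ, eQ⟩ := ih2
    refine ⟨P * Q, hP.mul hQ, fun ρ hρ => ?_⟩
    beta_reduce
    rw [eP ρ hρ, eQ ρ hρ, map_mul]
    field_simp
    ring
  | congr _ e ih =>
    obtain ⟨P, hP, eP⟩ := ih
    exact ⟨P, hP, fun ρ hρ => (e ρ hρ).trans (eP ρ hρ)⟩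

theorem weight_nonneg (d : ℕ →₀ ℕ) : 0 ≤ Finsupp.weight (fun i : ℕ => (i : ℤ) + 1) d := by
  rw [Finsupp.weight_apply]
  exact Finset.sum_nonneg fun i _ => by simp only [smul_eq_mul, nsmul_eq_mul]; positivity

theorem WC.eq_zero {r p : ℕ} {n : ℤ} {F : (ℕ → ℝ) → ℝ} (h : WC lam r p n F) (hn : n < 0)
    (ρ : ℕ → ℝ) (hρ : ρ 0 ≠ 0) : F ρ = 0 := by
  obtain ⟨P, hP, eP⟩ := h.poly
  have : P = 0 := by
    ext d
    by_contra hd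
    have := hP hd
    have := weight_nonneg d
    omega
  rw [eP ρ hρ, this]; simp

theorem WC.tsum {r p : ℕ} {n : ℤ} {F : ℕ → (ℕ → ℝ) → ℝ} (N : ℕ)
    (h : ∀ i, WC lam r p n (F i)) (hz : ∀ i, N ≤ i → ∀ ρ, ρ 0 ≠ 0 → F i ρ = 0) :
    WC lam r p n (fun ρ => ∑' i, F i ρ) := by
  refine (WC.sum (Finset.range N) fun i _ => h i).congr fun ρ hρ => ?_
  exact tsum_eq_sum fun i hi => hz i (by simpa using hi) ρ hρ

theorem update_zero_ne {ρ : ℕ → ℝ} (hρ : ρ 0 ≠ 0) (l : ℕ) :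
    ∀ᶠ t in nhds (ρ l), (Function.update ρ l t) 0 ≠ 0 := by
  rcases Nat.eq_zero_or_pos l with rfl | hl
  · simp only [Function.update_self]
    exact isOpen_ne.mem_nhds hρ
  · have : (0 : ℕ) ≠ l := by omega
    simp [Function.update_of_ne this, hρ]

theorem WC.deriv {r p : ℕ} {n : ℤ} {F : (ℕ → ℝ) → ℝ} (h : WC lam r p n F) :
    (∀ ρ : ℕ → ℝ, ρ 0 ≠ 0 → ∀ l, DifferentiableAt ℝ (fun t => F (Function.update ρ l t)) (ρ l)) ∧
    ∀ l : ℕ, WC lam r (p + 1) (n - l) (pdR F l) := by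
  induction h with
  | zero r p n =>
    exact ⟨fun ρ hρ l => by fun_prop, fun l => (WC.zero _ _ _).congr fun ρ hρ => by simp [pdR]⟩
  | const q =>
    exact ⟨fun ρ hρ l => by fun_prop, fun l => (WC.zero _ _ _).congr fun ρ hρ => by simp [pdR]⟩
  | lam4 =>
    exact ⟨fun ρ hρ l => by fun_prop, fun l => (WC.zero _ _ _).congr fun ρ hρ => by simp [pdR]⟩
  | inv =>
    constructor
    · intro ρ hρ l
      rcases Nat.eq_zero_or_pos l with rfl | hl
      · simpa using differentiableAt_inv hρ
      · have : (0 : ℕ) ≠ l := by omega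
        simp [Function.update_of_ne this]
    · intro l
      rcases Nat.eq_zero_or_pos l with rfl | hl
      · refine ((WC.inv.mul WC.inv).smul (-1)).cast rfl rfl (by simp) fun ρ hρ => ?_
        simp [pdR, pow_two]
      · have : (0 : ℕ) ≠ l := by omega
        refine (WC.zero _ _ _).congr fun ρ hρ => ?_
        simp [pdR, Function.update_of_ne this]
  | var i =>
    have key : ∀ ρ : ℕ → ℝ, ρ 0 ≠ 0 → ∀ l : ℕ,
        HasDerivAt (fun t => (Function.update ρ l t) (i + 1) / (Function.update ρ l t) 0)
          (if l = 0 then -(ρ (i + 1) / ρ 0 * (ρ 0)⁻¹) else if l = i + 1 then (ρ 0)⁻¹ else 0)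
          (ρ l) := by
      intro ρ hρ l
      by_cases h0 : l = 0
      · subst h0
        have := (hasDerivAt_inv hρ).const_mul (ρ (i + 1))
        simp only [Function.update_self, Function.update_of_ne (Nat.succ_ne_zero i), div_eq_mul_inv,
          if_true]
        refine this.congr_deriv ?_
        rw [← inv_pow]
        ring
      · have h0' : (0 : ℕ) ≠ l := fun h => h0 h.symm
        by_cases h1 : l = i + 1
        · subst h1
          simp only [Function.update_self, Function.update_of_ne h0', h0, if_true, if_false]
          simpa using (hasDerivAt_id (ρ (i + 1))).div_const (ρ 0)
        · have h1' : i + 1 ≠ l := fun h => h1 h.symm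
          simp only [Function.update_of_ne h0', Function.update_of_ne h1', h0, h1, if_false]
          exact hasDerivAt_const _ _
    refine ⟨fun ρ hρ l => (key ρ hρ l).differentiableAt, fun l => ?_⟩
    by_cases h0 : l = 0
    · refine (((WC.var i).mul WC.inv).smul (-1)).cast rfl rfl (by simp [h0]) fun ρ hρ => ?_
      rw [pdR, (key ρ hρ l).deriv]; simp [h0]
    · by_cases h1 : l = i + 1
      · refine WC.inv.cast rfl rfl (by simp [h1]) fun ρ hρ => ?_
        rw [pdR, (key ρ hρ l).deriv]; simp [h1]
      · refine (WC.zero _ _ _).congr fun ρ hρ => ?_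
        rw [pdR, (key ρ hρ l).deriv]; simp [h0, h1]
  | add _ _ ih1 ih2 =>
    refine ⟨fun ρ hρ l => (ih1.1 ρ hρ l).add (ih2.1 ρ hρ l), fun l => ?_⟩
    refine ((ih1.2 l).add (ih2.2 l)).congr fun ρ hρ => ?_
    exact deriv_fun_add (ih1.1 ρ hρ l) (ih2.1 ρ hρ l)
  | mul h1 h2 ih1 ih2 =>
    refine ⟨fun ρ hρ l => (ih1.1 ρ hρ l).mul (ih2.1 ρ hρ l), fun l => ?_⟩
    refine WC.congr (WC.add (((ih1.2 l).mul h2).cast rfl (by ring) (by ring) fun _ _ => rfl)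
      ((h1.mul (ih2.2 l)).cast rfl (by ring) (by ring) fun _ _ => rfl)) fun ρ hρ => ?_
    have := deriv_fun_mul (ih1.1 ρ hρ l) (ih2.1 ρ hρ l)
    simpa [pdR] using this
  | congr _ e ih =>
    have ev := fun (ρ : ℕ → ℝ) (hρ : ρ 0 ≠ 0) (l : ℕ) =>
      Filter.EventuallyEq.deriv_eq ((update_zero_ne hρ l).mono fun t ht => e _ ht)
    refine ⟨fun ρ hρ l => (ih.1 ρ hρ l).congr_of_eventuallyEq
      ((update_zero_ne hρ l).mono fun t ht => e _ ht), fun l => ?_⟩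
    exact (ih.2 l).congr fun ρ hρ => ev ρ hρ l

theorem WC.Sm (m : ℕ) : WC lam 0 0 m (fun ρ => Sm ρ m) := by
  unfold NCQFT.Sm bellP
  refine WC.sum _ fun i _ => ?_
  simp only [Finset.mul_sum, mul_ite, mul_zero]
  refine WC.sum _ fun j _ => ?_
  refine WC.ite _ fun hj => ?_
  have hprod := WC.prod (lam := lam) (Finset.univ : Finset (Fin m))
    (fun a _ => (WC.var (lam := lam) (a : ℕ)).pow (j a : ℕ))
  refine (hprod.smul ((-1) ^ i * (i.factorial : ℚ) *
    ((m.factorial : ℚ) / ∏ a : Fin m, ((j a : ℕ).factorial : ℚ)))).cast rfl rfl ?_ ?_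
  · refine Eq.trans ?_ (congrArg (Nat.cast : ℕ → ℤ) hj.2)
    push_cast
    exact Finset.sum_congr rfl fun a _ => by ring
  · intro ρ hρ
    have : ∏ a : Fin m, (ρ ((a : ℕ) + 1) / ρ 0) ^ (j a : ℕ)
        = ((ρ 0)⁻¹) ^ i * ∏ a : Fin m,
          ((((a : ℕ) + 1).factorial : ℝ) * ρ ((a : ℕ) + 1) / (((a : ℕ) + 1).factorial : ℝ)) ^
            (j a : ℕ) := by
      rw [← hj.1, ← Finset.prod_pow_eq_pow_sum, ← Finset.prod_mul_distrib]
      refine Finset.prod_congr rfl fun a _ => ?_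
      rw [← mul_pow]
      congr 1
      have : (((a : ℕ) + 1).factorial : ℝ) ≠ 0 := by positivity
      field_simp
    rw [this]
    push_cast
    ring

theorem WC.eBr (G : ℕ) (prev : ℕ → ℕ → (ℕ → ℝ) → ℝ)
    (hp : ∀ h, 1 ≤ h → h ≤ G + 1 → ∀ k : ℕ,
      WC lam h (2 * h - 1) (3 * (h : ℤ) - 2 - k) (prev h k)) (m : ℕ) :
    WC lam (G + 2) (2 * G + 2) (3 * (G : ℤ) + 4 - m) (fun ρ => eBr lam (G + 2) prev m ρ) := by
  have hG := hp (G + 1) (by omega) le_rfl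
  unfold NCQFT.eBr
  rw [show G + 2 - 1 = G + 1 from rfl]
  refine WC.add ?_ ?_
  · refine WC.sum _ fun h hh => WC.sum _ fun i _ => WC.sum _ fun j _ => WC.ite _ fun hij => ?_
    rw [Finset.mem_Icc] at hh
    refine ((hp h hh.1 hh.2 i).mul (hp (G + 2 - h) (by omega) (by omega) j)).cast
      (by omega) (by omega) ?_ fun _ _ => rfl
    rw [Nat.cast_sub (by omega)]
    push_cast
    omega
  · refine (WC.lam4.mul (r' := G + 1) (p' := 2 * G + 2) (n' := 3 * (G : ℤ) + 4 - m)
      (WC.add (WC.add ?_ ?_) ?_)).cast (by omega) (by omega) (by omega) fun _ _ => rfl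
    · refine WC.ite _ fun hm => ?_
      have hd := (hG (m - 2)).deriv.2
      have := WC.tsum (lam := lam) (r := G + 1) (p := 2 * G + 2) (n := 3 * (G : ℤ) + 4 - m)
        (F := fun l ρ => (-(3 + 2 * (l : ℚ)) : ℚ) * (ρ (l + 1) / ρ 0 * pdR (prev (G + 1) (m - 2)) l ρ))
        (3 * G + 4) (fun l => ?_) (fun l hl ρ hρ => ?_)
      · refine this.congr fun ρ hρ => ?_
        rw [← tsum_mul_left]
        refine tsum_congr fun l => ?_
        push_cast
        field_simp
      · refine (((WC.var l).mul (hd l)).smul _).cast (by omega) (by omega) ?_ fun _ _ => rfl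
        push_cast [Nat.cast_sub hm]
        ring
      · rw [(hd l).eq_zero _ ρ hρ]
        · simp
        · push_cast [Nat.cast_sub hm]; omega
    · refine WC.sum _ fun k _ => WC.sum _ fun l _ => WC.ite _ fun hkl => ?_
      refine (((hG k).deriv.2 l).smul (3 + 2 * (l : ℚ))).cast rfl (by omega) ?_ fun ρ _ => ?_
      · push_cast; omega
      · push_cast; ring
    · refine WC.ite _ fun hm => ?_
      refine ((WC.inv.mul (hG (m - 3))).smul (-((2 * (m - 3) + 3 : ℕ) : ℚ))).cast (by omega)
        (by omega) ?_ fun ρ _ => ?_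
      · push_cast [Nat.cast_sub hm]; ring
      · simp only [Rat.cast_neg, Rat.cast_natCast]; ring

theorem WC.Gtab (G : ℕ) : ∀ h, 1 ≤ h → h ≤ G → ∀ k : ℕ,
    WC lam h (2 * h - 1) (3 * (h : ℤ) - 2 - k) (Gtab lam G h k) := by
  induction G with
  | zero => intro h h1 h2; omega
  | succ G ih =>
    intro h h1 h2 k
    rcases G with _ | G
    · obtain rfl : h = 1 := by omega
      by_cases hk0 : k = 0
      · refine (((WC.lam4.mul WC.inv).mul (WC.var 0)).smul (1 / 8)).cast rfl rfl (by simp [hk0])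
          fun ρ hρ => ?_
        simp [NCQFT.Gtab, hk0]
        field_simp
        norm_num
        ring
      · by_cases hk1 : k = 1
        · refine ((WC.lam4.mul WC.inv).smul (-1 / 8)).cast rfl rfl (by simp [hk1])
            fun ρ hρ => ?_
          simp [NCQFT.Gtab, hk1]
          field_simp
          norm_num
          ring
        · refine (WC.zero _ _ _).congr fun ρ hρ => ?_
          simp [NCQFT.Gtab, hk0, hk1]
    · by_cases hle : h ≤ G + 1
      · refine (ih h h1 hle k).congr fun ρ _ => ?_
        rw [NCQFT.Gtab]
        simp only [if_pos hle]
      · obtain rfl : h = G + 2 := by omega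
        have he := fun m => WC.eBr G (NCQFT.Gtab lam (G + 1)) ih m
        have := WC.tsum (lam := lam) (r := G + 2) (p := 2 * G + 2) (n := 3 * (G : ℤ) + 4 - k)
          (F := fun j ρ => NCQFT.eBr lam (G + 2) (NCQFT.Gtab lam (G + 1)) (k + j) ρ *
            NCQFT.Sm ρ j / (j.factorial : ℝ))
          (3 * G + 5) (fun j => ?_) (fun j hj ρ hρ => ?_)
        · refine ((WC.inv.mul this).smul (-1 / 2)).cast (by omega) (by omega)
            (by push_cast; ring) fun ρ _ => ?_
          rw [NCQFT.Gtab]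
          simp only [if_neg hle, if_true]
          push_cast
          ring
        · refine (((he (k + j)).mul (WC.Sm j)).smul (1 / (j.factorial : ℚ))).cast (by omega)
            (by omega) (by push_cast; ring) fun ρ _ => ?_
          push_cast
          ring
        · have := (he (k + j)).eq_zero (by push_cast; omega) ρ hρ
          simp only [this]
          simp

theorem WC.finPoly {r p : ℕ} (j : ℕ) {F : (ℕ → ℝ) → ℝ} (h : WC lam r p j F) :
    ∃ P : MvPolynomial (Fin j) ℚ, IsWeighted j P ∧
      ∀ ρ : ℕ → ℝ, ρ 0 ≠ 0 →
        F ρ = (2 * lam) ^ (4 * r) *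
          (MvPolynomial.aeval (fun i : Fin j => ρ ((i : ℕ) + 1) / ρ 0) P : ℝ) / ρ 0 ^ p := by
  obtain ⟨P, hP, eP⟩ := h.poly
  have hvars : (P.vars : Set ℕ) ⊆ Set.range (fun i : Fin j => (i : ℕ)) := by
    intro i hi
    obtain ⟨d, hd, hid⟩ := (MvPolynomial.mem_vars i).1 (Finset.mem_coe.1 hi)
    have hw := hP (MvPolynomial.mem_support_iff.1 hd)
    rw [Finsupp.weight_apply, Finsupp.sum] at hw
    have h1 := Finset.single_le_sum (f := fun a => d a • ((a : ℤ) + 1))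
      (fun a _ => by simp only [nsmul_eq_mul]; positivity) hid
    have h2 : 1 ≤ d i := Nat.one_le_iff_ne_zero.2 (Finsupp.mem_support_iff.1 hid)
    simp only [nsmul_eq_mul] at h1 hw
    have h3 : (i : ℤ) + 1 ≤ d i * ((i : ℤ) + 1) := by
      have : (1 : ℤ) ≤ d i := by exact_mod_cast h2
      nlinarith
    exact ⟨⟨i, by omega⟩, rfl⟩
  obtain ⟨Q, rfl⟩ := MvPolynomial.exists_rename_eq_of_vars_subset_range P
    (fun i : Fin j => (i : ℕ)) Fin.val_injective hvars
  refine ⟨Q, fun m hm => ?_, fun ρ hρ => ?_⟩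
  · have hc : MvPolynomial.coeff (m.mapDomain (fun i : Fin j => (i : ℕ)))
        (MvPolynomial.rename (fun i : Fin j => (i : ℕ)) Q) ≠ 0 := by
      rw [MvPolynomial.coeff_rename_mapDomain _ Fin.val_injective]
      exact MvPolynomial.mem_support_iff.1 hm
    have hw := hP hc
    rw [Finsupp.weight_apply, Finsupp.sum_mapDomain_index (by simp) (by intros; simp; ring),
      Finsupp.sum_fintype _ _ (by simp)] at hw
    have : ((∑ i : Fin j, ((i : ℕ) + 1) * m i : ℕ) : ℤ) = j := by
      rw [← hw]; push_cast
      exact Finset.sum_congr rfl fun a _ => by simp [mul_comm]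
    exact_mod_cast this
  · rw [eP ρ hρ, MvPolynomial.aeval_rename]
    rfl

end NCQFT

open NCQFT in
/-- For every `g ≥ 1` there are a rational constant `P₀` and `j`-weighted
polynomials `P_j` (`1 ≤ j ≤ 3g−2`) with rational coefficients in `ϱ₁/ϱ₀,…,ϱ_j/ϱ₀` with
`𝒢_g(z) = (2λ)^{4g} Σ_{k=0}^{3g−2} P_{3g−2−k}/(ϱ₀^{2g−1} z^{2k+3})`. -/
theorem stmt8 (lam : ℝ) (hlam : lam ≠ 0) (g : ℕ) (hg : 1 ≤ g) :
    ∃ P : (j : ℕ) → MvPolynomial (Fin j) ℚ,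
      (∀ j, IsWeighted j (P j)) ∧
      ∀ ρ : ℕ → ℝ, ρ 0 ≠ 0 → ∀ z : ℂ, z ≠ 0 →
        Gfun lam g ρ z = (2 * (lam : ℂ)) ^ (4 * g) *
          ∑ k ∈ Finset.range (3 * g - 1),
            (((MvPolynomial.aeval (fun i : Fin (3 * g - 2 - k) =>
                ρ ((i : ℕ) + 1) / ρ 0) (P (3 * g - 2 - k)) : ℝ)) : ℂ) /
              ((ρ 0 : ℂ) ^ (2 * g - 1) * z ^ (2 * k + 3)) := by
  have hW : ∀ k : ℕ, WC lam g (2 * g - 1) (3 * (g : ℤ) - 2 - k) (Gcoef lam g k) :=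
    WC.Gtab g g hg le_rfl
  have hex : ∀ j : ℕ, ∃ P : MvPolynomial (Fin j) ℚ, IsWeighted j P ∧
      (j ≤ 3 * g - 2 → ∀ ρ : ℕ → ℝ, ρ 0 ≠ 0 →
        Gcoef lam g (3 * g - 2 - j) ρ = (2 * lam) ^ (4 * g) *
          (MvPolynomial.aeval (fun i : Fin j => ρ ((i : ℕ) + 1) / ρ 0) P : ℝ) /
            ρ 0 ^ (2 * g - 1)) := by
    intro j
    by_cases hj : j ≤ 3 * g - 2
    · obtain ⟨P, h1, h2⟩ := WC.finPoly j ((hW (3 * g - 2 - j)).cast rfl rfl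
        (by omega) (fun _ _ => rfl))
      exact ⟨P, h1, fun _ => h2⟩
    · exact ⟨0, fun m hm => by simp at hm, fun h => absurd h hj⟩
  choose P hP1 hP2 using hex
  refine ⟨P, hP1, fun ρ hρ z hz => ?_⟩
  unfold Gfun
  rw [tsum_eq_sum (s := Finset.range (3 * g - 1)), Finset.mul_sum]
  · refine Finset.sum_congr rfl fun k hk => ?_
    rw [Finset.mem_range] at hk
    have := hP2 (3 * g - 2 - k) (by omega) ρ hρ
    rw [show 3 * g - 2 - (3 * g - 2 - k) = k by omega] at this
    rw [this]
    push_cast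
    field_simp
  · intro k hk
    rw [Finset.mem_range] at hk
    rw [(hW k).eq_zero (by omega) ρ hρ]
    simp
end
end
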